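/- Let p be a prime, let n >= 2 be an integer and let delta > 0 be a constant. Then there exist constants C > 0 and Q > 0 (depending only on p, n and delta) such that for every q = p^h with q >= Q and every nonzero code word c of C_n(H(2n+1,q^2))^perp with wt(c) <= delta * q^{2n-1}, writing S = supp(c), there exists an n-dimensional projective subspace pi of PG(2n+1,q^2) such that, with i the projective dimension of pi intersect pi^sigma: (a) -1 <= i <= n-2; (b) the number of points of S lying on exactly one of pi and pi^sigma is greater than C * q^{2n-1}; and (c) ((p-1)/p) times the number of points of H(2n+1,q^2) lying on exactly one of pi and pi^sigma is less than Sigma_{n,i} - C * q^{2n-1}. -/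

import Mathlib

open scoped BigOperators

namespace HermCode

/-- The Hermitian sesquilinear form `h(x,y) = ∑ᵢ xᵢ * yᵢ^q` on `F^m`. -/
def herm (q : ℕ) {F : Type} [Field F] {m : ℕ} (x y : Fin m → F) : F :=
  ∑ i, x i * (y i) ^ q

/-- For a fixed vector `x`, the linear map `y ↦ h(y,x)`. -/
def hermL (q : ℕ) {F : Type} [Field F] {m : ℕ} (x : Fin m → F) :
    (Fin m → F) →ₗ[F] F where
  toFun y := herm q y x
  map_add' a b := by
    simp [herm, add_mul, Finset.sum_add_distrib]
  map_smul' c a := by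
    simp [herm, Finset.mul_sum, mul_assoc]

/-- The image `W^σ` of a subspace `W` under the Hermitian polarity `σ`:
the subspace of all vectors orthogonal to every vector of `W`
with respect to the Hermitian form. -/
def polar (q : ℕ) {F : Type} [Field F] {m : ℕ} (W : Submodule F (Fin m → F)) :
    Submodule F (Fin m → F) :=
  ⨅ x : W, LinearMap.ker (hermL q (x : Fin m → F))

/-- A subspace all of whose points lie on the Hermitian variety. -/
def TotallyIsotropic (q : ℕ) {F : Type} [Field F] {m : ℕ}
    (W : Submodule F (Fin m → F)) : Prop :=
  ∀ x ∈ W, herm q x x = 0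

/-- A point of the Hermitian variety: a projective point (1-dimensional subspace)
spanned by an isotropic vector. -/
def IsHermPoint (q : ℕ) {F : Type} [Field F] {m : ℕ}
    (P : Submodule F (Fin m → F)) : Prop :=
  Module.finrank F P = 1 ∧ TotallyIsotropic q P

/-- A generator of `H(2n+1,q²)`: an `n`-dimensional projective subspace all of
whose points lie on the Hermitian variety. -/
def IsGenerator (q n : ℕ) {F : Type} [Field F]
    (W : Submodule F (Fin (2*n+2) → F)) : Prop :=
  Module.finrank F W = n + 1 ∧ TotallyIsotropic q W

/-- A code word of the dual code `C_n(H(2n+1,q²))^⊥`: a function from points to `F_p`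
(vanishing off the Hermitian variety) summing to zero over every generator. -/
def IsCodeword (p q n : ℕ) {F : Type} [Field F]
    (c : Submodule F (Fin (2*n+2) → F) → ZMod p) : Prop :=
  (∀ P, ¬ IsHermPoint q P → c P = 0) ∧
  ∀ μ, IsGenerator q n μ → (∑ᶠ P ∈ {P | IsHermPoint q P ∧ P ≤ μ}, c P) = 0

/-- The (Hamming) weight of a code word. -/
noncomputable def wt {p : ℕ} {α : Type*} (c : α → ZMod p) : ℕ :=
  Nat.card {x : α // c x ≠ 0}

open scoped Classical in
/-- The incidence vector `v_π` of `π ∩ H`. -/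
noncomputable def vsub (p q : ℕ) {F : Type} [Field F] {m : ℕ}
    (π : Submodule F (Fin m → F)) : Submodule F (Fin m → F) → ZMod p :=
  fun P => if IsHermPoint q P ∧ P ≤ π then 1 else 0

/-- `θ_m(q)`, the number of points of `PG(m,q)`. -/
noncomputable def theta (q : ℕ) (m : ℤ) : ℚ :=
  ((q:ℚ)^(m+1) - 1) / ((q:ℚ) - 1)

/-- `μ_m(q²)`, the number of points of `H(m,q²)` (with `μ_{-1} = 0`). -/
noncomputable def muH (q : ℕ) (m : ℤ) : ℚ :=
  (((q:ℚ)^(m+1) - (-1:ℚ)^(m+1)) * ((q:ℚ)^m - (-1:ℚ)^m)) / ((q:ℚ)^2 - 1)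

/-- The number `N(n,i)`. -/
noncomputable def NN (q n : ℕ) (i : ℤ) : ℚ :=
  (q:ℚ)^(((n:ℤ)-1)^2 - ((((n:ℤ)-i-1).toNat.choose 2 : ℕ) : ℤ)) *
    ∏ j ∈ Finset.range ((n:ℤ)-i-2).toNat, ((q:ℚ)^(j+1) - (-1:ℚ)^(j+1))

open scoped Classical in
/-- The quantity `Σ_{n,i}`. -/
noncomputable def SigmaNI (q n : ℕ) (i : ℤ) : ℚ :=
  if Odd ((n:ℤ) - i) then
    2*(q:ℚ)^(2*i+2) * muH q ((n:ℤ)-i-1)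
      + 4 * muH q ((n:ℤ)-i-2) * ((q:ℚ)^((n:ℤ)-i-1) - 1)
          / ((q:ℚ)^((n:ℤ)-3*i-5) * ((q:ℚ)^2 - 1))
  else
    2*(q:ℚ)^(2*i+2) * (muH q ((n:ℤ)-i-1)
      + 2*((q:ℚ)^(4:ℤ) * muH q ((n:ℤ)-i-3) + (q:ℚ)^2 - 1)/((q:ℚ)^2 - 1))

/-- `P` lies on a projective line entirely contained in the Hermitian variety that
meets both `π \ (π ⊓ π^σ)` and `π^σ \ (π ⊓ π^σ)`. -/
def OnGoodLine (q : ℕ) {F : Type} [Field F] {m : ℕ}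
    (π P : Submodule F (Fin m → F)) : Prop :=
  ∃ A B : Submodule F (Fin m → F),
    Module.finrank F A = 1 ∧ A ≤ π ∧ ¬ A ≤ π ⊓ polar q π ∧
    Module.finrank F B = 1 ∧ B ≤ polar q π ∧ ¬ B ≤ π ⊓ polar q π ∧
    P ≤ A ⊔ B ∧ TotallyIsotropic q (A ⊔ B)

/-- Working hypotheses on the field: order `q²` and additivity of `x ↦ x^q`. -/
structure GoodField (q : ℕ) (F : Type) [Field F] [Fintype F] : Prop where
  two_le : 2 ≤ q
  card : Fintype.card F = q ^ 2
  add : ∀ x y : F, (x + y) ^ q = x ^ q + y ^ q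

set_option linter.unusedSectionVars false

section Basic

variable {q : ℕ} {F : Type} [Field F] [Fintype F] {m : ℕ}

lemma GoodField.pow_pow (H : GoodField q F) (x : F) : (x ^ q) ^ q = x := by
  rw [← pow_mul, ← pow_two, ← H.card]; exact FiniteField.pow_card x

lemma GoodField.frob_inj (H : GoodField q F) {x y : F} (h : x ^ q = y ^ q) : x = y := by
  rw [← H.pow_pow x, h, H.pow_pow]

lemma GoodField.sum_pow (H : GoodField q F) {ι : Type*} (s : Finset ι) (f : ι → F) :
    (∑ i ∈ s, f i) ^ q = ∑ i ∈ s, f i ^ q := by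
  classical
  have h0 : (0 : F) ^ q = 0 := zero_pow (by have := H.two_le; omega)
  induction s using Finset.induction_on with
  | empty => simp [h0]
  | insert a s ha ih => rw [Finset.sum_insert ha, Finset.sum_insert ha, H.add, ih]

lemma hermL_apply (x y : Fin m → F) : hermL q x y = herm q y x := rfl

lemma herm_add_left (x y z : Fin m → F) : herm q (x + y) z = herm q x z + herm q y z :=
  (hermL q z).map_add x y

lemma herm_smul_left (a : F) (x z : Fin m → F) : herm q (a • x) z = a * herm q x z :=
  (hermL q z).map_smul a x

lemma GoodField.herm_symm (H : GoodField q F) (x y : Fin m → F) :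
    herm q y x = (herm q x y) ^ q := by
  unfold herm
  rw [H.sum_pow]
  refine Finset.sum_congr rfl fun i _ => ?_
  rw [mul_pow, H.pow_pow, mul_comm]

lemma GoodField.herm_add_right (H : GoodField q F) (x y z : Fin m → F) :
    herm q z (x + y) = herm q z x + herm q z y := by
  rw [H.herm_symm (x + y) z, herm_add_left, H.add, ← H.herm_symm, ← H.herm_symm]

lemma GoodField.herm_smul_right (H : GoodField q F) (a : F) (x z : Fin m → F) :
    herm q z (a • x) = a ^ q * herm q z x := by
  rw [H.herm_symm (a • x) z, herm_smul_left, mul_pow, ← H.herm_symm]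

lemma GoodField.herm_comm_zero (H : GoodField q F) {x y : Fin m → F} (h : herm q x y = 0) :
    herm q y x = 0 := by
  rw [H.herm_symm x y, h, zero_pow]; have := H.two_le; omega

lemma mem_polar {W : Submodule F (Fin m → F)} {y : Fin m → F} :
    y ∈ polar q W ↔ ∀ x ∈ W, herm q y x = 0 := by
  simp [polar, Submodule.mem_iInf, hermL_apply]

lemma GoodField.le_polar_polar (H : GoodField q F) (W : Submodule F (Fin m → F)) :
    W ≤ polar q (polar q W) := by
  intro x hx
  rw [mem_polar]
  intro y hy
  exact H.herm_comm_zero (mem_polar.1 hy x hx)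

open scoped Classical in
lemma GoodField.card_mem (H : GoodField q F) (U : Submodule F (Fin m → F)) :
    (Finset.univ.filter (fun x => x ∈ U)).card = q ^ (2 * Module.finrank F U) := by
  have := Module.card_eq_pow_finrank (K := F) (V := U)
  rw [H.card, ← pow_mul] at this
  rw [← this, Fintype.card_subtype]

lemma GoodField.hermL_inj (H : GoodField q F) {x y : Fin m → F}
    (h : hermL q x = hermL q y) : x = y := by
  funext i
  have := congrArg (fun f => f (Pi.single i 1)) h
  simp [hermL, herm, Pi.single_apply] at this
  exact H.frob_inj this

lemma GoodField.finrank_polar (H : GoodField q F) (W : Submodule F (Fin m → F)) :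
    Module.finrank F W + Module.finrank F (polar q W) = m := by
  classical
  let Φ : Submodule F (Module.Dual F (Fin m → F)) :=
    { carrier := {f | ∃ w ∈ W, hermL q w = f}
      add_mem' := by
        rintro _ _ ⟨a, ha, rfl⟩ ⟨b, hb, rfl⟩
        refine ⟨a + b, W.add_mem ha hb, ?_⟩
        refine LinearMap.ext fun z => ?_; simp [hermL_apply, H.herm_add_right]
      zero_mem' := by
        refine ⟨0, W.zero_mem, ?_⟩
        have : q ≠ 0 := by have := H.two_le; omega
        refine LinearMap.ext fun z => ?_; simp [hermL_apply, herm, this]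
      smul_mem' := by
        rintro c _ ⟨a, ha, rfl⟩
        refine ⟨c ^ q • a, W.smul_mem _ ha, ?_⟩
        refine LinearMap.ext fun z => ?_; simp [hermL_apply, H.herm_smul_right, H.pow_pow] }
  have h1 : polar q W = Φ.dualCoannihilator := by
    ext y
    rw [mem_polar, Submodule.mem_dualCoannihilator]
    constructor
    · rintro h _ ⟨w, hw, rfl⟩; exact h w hw
    · intro h x hx; exact h _ ⟨x, hx, rfl⟩
  have h2 : Module.finrank F W = Module.finrank F Φ := by
    have e : W ≃ Φ := Equiv.ofBijective (fun w => ⟨hermL q (w : Fin m → F), w, w.2, rfl⟩)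
      ⟨fun a b hab => Subtype.ext (H.hermL_inj (Subtype.ext_iff.1 hab)),
       fun ⟨f, w, hw, hf⟩ => ⟨⟨w, hw⟩, Subtype.ext hf⟩⟩
    have c := Nat.card_congr e
    rw [Module.natCard_eq_pow_finrank (K := F) (V := W),
      Module.natCard_eq_pow_finrank (K := F) (V := Φ)] at c
    refine Nat.pow_right_injective (a := Nat.card F) ?_ c
    rw [Nat.card_eq_fintype_card, H.card]; have := H.two_le; nlinarith
  rw [h1, h2, Subspace.finrank_add_finrank_dualCoannihilator_eq]; simp

lemma GoodField.polar_polar (H : GoodField q F) (W : Submodule F (Fin m → F)) :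
    polar q (polar q W) = W := by
  refine (Submodule.eq_of_le_of_finrank_eq (H.le_polar_polar W) ?_).symm
  have := H.finrank_polar W
  have := H.finrank_polar (polar q W)
  omega

lemma polar_anti {W W' : Submodule F (Fin m → F)} (h : W ≤ W') : polar q W' ≤ polar q W := by
  intro x hx
  rw [mem_polar] at hx ⊢
  exact fun y hy => hx y (h hy)

/-- number of solutions of `t + t^q = 0` is not everything -/
lemma GoodField.exists_trace_ne (H : GoodField q F) : ∃ t : F, t + t ^ q ≠ 0 := by
  classical
  by_contra hcon
  push Not at hcon
  let P : Polynomial F := Polynomial.X ^ q + Polynomial.X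
  have hq := H.two_le
  have hd : P.natDegree = q := by
    show (Polynomial.X ^ q + Polynomial.X : Polynomial F).natDegree = q
    compute_degree!
    all_goals first | omega | (split_ifs <;> first | omega | simp)
  have hP : P ≠ 0 := by intro h; rw [h] at hd; simp at hd; omega
  have h2 : (Finset.univ : Finset F) ⊆ P.roots.toFinset := by
    intro t _
    rw [Multiset.mem_toFinset, Polynomial.mem_roots hP]
    simp [P, add_comm, hcon t]
  have h3 := Finset.card_le_card h2
  have h4 := P.roots.toFinset_card_le
  have h5 := P.card_roots'
  rw [Finset.card_univ, H.card] at h3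
  nlinarith

lemma GoodField.ti_iff (H : GoodField q F) (W : Submodule F (Fin m → F)) :
    TotallyIsotropic q W ↔ W ≤ polar q W := by
  constructor
  · intro h x hx
    rw [mem_polar]
    intro y hy
    by_contra hne
    obtain ⟨t, ht⟩ := H.exists_trace_ne
    have h0 := h ((t / herm q x y) • x + y) (W.add_mem (W.smul_mem _ hx) hy)
    rw [herm_add_left, H.herm_add_right, H.herm_add_right, herm_smul_left, herm_smul_left,
      H.herm_smul_right, H.herm_smul_right, h x hx, h y hy, H.herm_symm x y, ← mul_pow,
      div_mul_cancel₀ _ hne] at h0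
    apply ht
    simpa using h0
  · intro h x hx
    exact mem_polar.1 (h hx) x hx

open scoped Classical in
lemma GoodField.norm_fiber (H : GoodField q F) {a : F} (ha : a ≠ 0) (haq : a ^ q = a) :
    (Finset.univ.filter (fun l : F => l ^ (q + 1) = a)).card = q + 1 := by
  have hq := H.two_le
  let B : Finset F := Finset.univ.filter (fun b => b ≠ 0 ∧ b ^ q = b)
  have hfib : ∀ b : F, (Finset.univ.filter (fun l : F => l ^ (q + 1) = b)).card ≤ q + 1 := by
    intro b
    have : (Finset.univ.filter (fun l : F => l ^ (q + 1) = b)) ⊆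
        (Polynomial.nthRoots (q + 1) b).toFinset := by
      intro l hl
      rw [Multiset.mem_toFinset, Polynomial.mem_nthRoots (by omega)]
      simpa using hl
    exact (Finset.card_le_card this).trans
      ((Multiset.toFinset_card_le _).trans (Polynomial.card_nthRoots _ _))
  have hB : B.card ≤ q - 1 := by
    have : B ⊆ (Polynomial.nthRoots (q - 1) (1 : F)).toFinset := by
      intro l hl
      rw [Multiset.mem_toFinset, Polynomial.mem_nthRoots (by omega)]
      obtain ⟨h0, h1⟩ := (Finset.mem_filter.1 hl).2
      apply mul_right_cancel₀ h0
      rw [← pow_succ, Nat.sub_add_cancel (by omega), h1, one_mul]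
    exact (Finset.card_le_card this).trans
      ((Multiset.toFinset_card_le _).trans (Polynomial.card_nthRoots _ _))
  have hsum : (Finset.univ.filter (fun l : F => l ≠ 0)).card =
      ∑ b ∈ B, ((Finset.univ.filter (fun l : F => l ≠ 0)).filter
        (fun l : F => l ^ (q + 1) = b)).card := by
    apply Finset.card_eq_sum_card_fiberwise
    intro l hl
    have hl : l ≠ 0 := by simpa using hl
    simp only [B, Finset.coe_filter, Finset.mem_univ, true_and, Set.mem_ofPred_eq]
    refine ⟨pow_ne_zero _ hl, ?_⟩
    rw [pow_succ, mul_pow, H.pow_pow, mul_comm]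
  have hle : ∀ b, ((Finset.univ.filter (fun l : F => l ≠ 0)).filter
        (fun l : F => l ^ (q + 1) = b)).card ≤
        (Finset.univ.filter (fun l : F => l ^ (q + 1) = b)).card := fun b =>
    Finset.card_le_card (Finset.filter_subset_filter _ (Finset.filter_subset _ _))
  have hcard : (Finset.univ.filter (fun l : F => l ≠ 0)).card = q ^ 2 - 1 := by
    rw [Finset.filter_ne', Finset.card_erase_of_mem (Finset.mem_univ _), Finset.card_univ, H.card]
  by_contra hne
  have hlt : (Finset.univ.filter (fun l : F => l ^ (q + 1) = a)).card < q + 1 :=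
    lt_of_le_of_ne (hfib a) hne
  have haB : a ∈ B := by simp [B, ha, haq]
  have h1 : ∑ b ∈ B, ((Finset.univ.filter (fun l : F => l ≠ 0)).filter
        (fun l : F => l ^ (q + 1) = b)).card < ∑ b ∈ B, (q + 1) :=
    Finset.sum_lt_sum (fun b _ => (hle b).trans (hfib b)) ⟨a, haB, (hle a).trans_lt hlt⟩
  rw [← hsum, hcard, Finset.sum_const, smul_eq_mul] at h1
  have h2 : B.card * (q + 1) ≤ (q - 1) * (q + 1) := Nat.mul_le_mul_right _ hB
  have h3 : (q - 1) * (q + 1) = q ^ 2 - 1 := by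
    obtain ⟨k, rfl⟩ : ∃ k, q = k + 1 := ⟨q - 1, by omega⟩
    have : (k + 1) ^ 2 = k * (k + 1 + 1) + 1 := by ring
    simp [this]
  omega

open scoped Classical in
/-- The set of isotropic vectors of a subspace. -/
noncomputable def iso (q : ℕ) {F : Type} [Field F] [Fintype F] {m : ℕ}
    (U : Submodule F (Fin m → F)) : Finset (Fin m → F) :=
  Finset.univ.filter (fun x => x ∈ U ∧ herm q x x = 0)

lemma mem_iso {U : Submodule F (Fin m → F)} {x : Fin m → F} :
    x ∈ iso q U ↔ x ∈ U ∧ herm q x x = 0 := by simp [iso]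

open scoped Classical in
lemma GoodField.card_iso_ti (H : GoodField q F) {U : Submodule F (Fin m → F)}
    (h : TotallyIsotropic q U) : (iso q U).card = q ^ (2 * Module.finrank F U) := by
  rw [← H.card_mem]
  congr 1
  ext x
  simp only [mem_iso, Finset.mem_filter, Finset.mem_univ, true_and]
  exact ⟨fun h => h.1, fun hx => ⟨hx, h x hx⟩⟩

/-- hyperplane section of `U` by `y^⊥` -/
def sec (q : ℕ) {F : Type} [Field F] {m : ℕ} (U : Submodule F (Fin m → F)) (y : Fin m → F) :
    Submodule F (Fin m → F) := U ⊓ LinearMap.ker (hermL q y)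

lemma mem_sec {U : Submodule F (Fin m → F)} {x y : Fin m → F} :
    x ∈ sec q U y ↔ x ∈ U ∧ herm q x y = 0 := by
  simp [sec, hermL_apply]

lemma finrank_sec {U : Submodule F (Fin m → F)} {y : Fin m → F} (hy : y ∈ U)
    (hyy : herm q y y ≠ 0) : Module.finrank F (sec q U y) + 1 = Module.finrank F U := by
  have h1 := LinearMap.finrank_range_add_finrank_ker ((hermL q y).domRestrict U)
  have h2 : LinearMap.range ((hermL q y).domRestrict U) = ⊤ := by
    rw [LinearMap.range_eq_top]
    intro a
    refine ⟨(a / herm q y y) • ⟨y, hy⟩, ?_⟩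
    have : (hermL q y) y = herm q y y := rfl
    simp [this, hyy]
  rw [h2, finrank_top, Module.finrank_self] at h1
  have h3 : Module.finrank F (LinearMap.ker ((hermL q y).domRestrict U)) =
      Module.finrank F (sec q U y) := by
    rw [sec, LinearMap.ker_domRestrict]
    rw [← Submodule.finrank_map_subtype_eq U, Submodule.map_comap_subtype]
  omega

open scoped Classical in
lemma GoodField.iso_rec (H : GoodField q F) {U : Submodule F (Fin m → F)} {y : Fin m → F}
    (hy : y ∈ U) (hyy : herm q y y ≠ 0) :
    (iso q U).card + q * (iso q (sec q U y)).card =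
      (q + 1) * q ^ (2 * Module.finrank F (sec q U y)) := by
  have hq := H.two_le
  set U' := sec q U y with hU'
  let pr : (Fin m → F) → (Fin m → F) := fun x => x - (herm q x y / herm q y y) • y
  have hpr : ∀ x ∈ U, pr x ∈ U' := by
    intro x hx
    rw [hU', mem_sec]
    refine ⟨U.sub_mem hx (U.smul_mem _ hy), ?_⟩
    have := (hermL q y).map_sub x ((herm q x y / herm q y y) • y)
    change herm q (x - _) y = herm q x y - herm q _ y at this
    rw [this, herm_smul_left, div_mul_cancel₀ _ hyy, sub_self]
  have hsum : (iso q U).card = ∑ x' ∈ Finset.univ.filter (fun x => x ∈ U'),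
      ((iso q U).filter (fun x => pr x = x')).card := by
    apply Finset.card_eq_sum_card_fiberwise
    intro x hx
    have hx := mem_iso.1 (Finset.mem_coe.1 hx)
    simpa using hpr x hx.1
  have hval : ∀ x' ∈ U', ∀ l : F, herm q (x' + l • y) (x' + l • y) =
      herm q x' x' + l ^ (q + 1) * herm q y y := by
    intro x' hx' l
    have h1 := (mem_sec.1 hx').2
    have h2 := H.herm_comm_zero h1
    rw [herm_add_left, H.herm_add_right, H.herm_add_right, herm_smul_left, herm_smul_left,
      H.herm_smul_right, H.herm_smul_right, h1, h2]
    ring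
  have hfib : ∀ x' ∈ U', ((iso q U).filter (fun x => pr x = x')).card =
      if herm q x' x' = 0 then 1 else q + 1 := by
    intro x' hx'
    have himg : (iso q U).filter (fun x => pr x = x') =
        (Finset.univ.filter (fun l : F => l ^ (q + 1) = - herm q x' x' / herm q y y)).image
          (fun l => x' + l • y) := by
      ext x
      simp only [Finset.mem_filter, mem_iso, Finset.mem_image, Finset.mem_univ, true_and]
      constructor
      · rintro ⟨⟨hx, h0⟩, hp⟩
        have hxe : x = x' + (herm q x y / herm q y y) • y := by rw [← hp]; simp [pr]
        refine ⟨herm q x y / herm q y y, ?_, hxe.symm⟩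
        rw [hxe, hval x' hx'] at h0
        rw [eq_div_iff hyy]
        linear_combination h0
      · rintro ⟨l, hl, rfl⟩
        refine ⟨⟨U.add_mem (mem_sec.1 hx').1 (U.smul_mem _ hy), ?_⟩, ?_⟩
        · rw [hval x' hx', hl, div_mul_cancel₀ _ hyy]; ring
        · simp only [pr]
          rw [herm_add_left, herm_smul_left, (mem_sec.1 hx').2, zero_add,
            mul_div_cancel_right₀ _ hyy]
          simp
    have hy0 : y ≠ 0 := by
      rintro rfl
      apply hyy; simp [herm]
    rw [himg, Finset.card_image_of_injective]
    · split_ifs with h0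
      · rw [h0, neg_zero, zero_div]
        rw [Finset.card_eq_one]
        refine ⟨0, ?_⟩
        ext l; simp
      · apply H.norm_fiber
        · exact div_ne_zero (neg_ne_zero.2 h0) hyy
        · have hneg : (-1 : F) ^ q = -1 := by
            have := H.add (-1) 1
            rw [neg_add_cancel, zero_pow (by omega), one_pow] at this
            linear_combination -this
          rw [div_pow, ← H.herm_symm, neg_eq_neg_one_mul, mul_pow, hneg, ← H.herm_symm]
    · intro a b hab
      have := add_left_cancel hab
      exact smul_left_injective F hy0 this
  rw [hsum, Finset.sum_congr rfl (fun x' hx' => hfib x' (by simpa using hx'))]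
  rw [← H.card_mem U']
  have h5 : (iso q U').card = ∑ x' ∈ Finset.univ.filter (fun x => x ∈ U'),
      if herm q x' x' = 0 then 1 else 0 := by
    rw [← Finset.card_filter]
    congr 1
    ext x; simp [mem_iso]
  rw [h5, Finset.mul_sum, ← Finset.sum_add_distrib, mul_comm, ← smul_eq_mul, ← Finset.sum_const]
  refine Finset.sum_congr rfl fun x _ => ?_
  split_ifs <;> omega

/-- number of isotropic vectors as a function of dimension of radical `d` and rank `r` -/
def isoCount (q d : ℕ) : ℕ → ℕ
  | 0 => q ^ (2 * d)
  | r + 1 => (q + 1) * q ^ (2 * (d + r)) - q * isoCount q d r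

lemma GoodField.exists_nonisotropic {U : Submodule F (Fin m → F)}
    (h : ¬ TotallyIsotropic q U) : ∃ y ∈ U, herm q y y ≠ 0 := by
  unfold TotallyIsotropic at h
  push Not at h
  exact h

lemma GoodField.rad_sec (H : GoodField q F) {U : Submodule F (Fin m → F)} {y : Fin m → F}
    (hy : y ∈ U) (hyy : herm q y y ≠ 0) :
    sec q U y ⊓ polar q (sec q U y) = U ⊓ polar q U := by
  ext x
  simp only [Submodule.mem_inf, mem_polar, mem_sec]
  constructor
  · rintro ⟨⟨hx, hxy⟩, h⟩
    refine ⟨hx, fun z hz => ?_⟩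
    have h1 := h (z - (herm q z y / herm q y y) • y) ⟨U.sub_mem hz (U.smul_mem _ hy), by
      have := (hermL q y).map_sub z ((herm q z y / herm q y y) • y)
      change herm q (z - _) y = herm q z y - herm q _ y at this
      rw [this, herm_smul_left, div_mul_cancel₀ _ hyy, sub_self]⟩
    have h2 := H.herm_add_right (z - (herm q z y / herm q y y) • y)
      ((herm q z y / herm q y y) • y) x
    rw [sub_add_cancel, h1, H.herm_smul_right, hxy] at h2
    rw [h2]; ring
  · rintro ⟨hx, h⟩
    exact ⟨⟨hx, h y hy⟩, fun z hz => h z hz.1⟩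

lemma GoodField.card_iso (H : GoodField q F) (d : ℕ) : ∀ (r : ℕ) (U : Submodule F (Fin m → F)),
    Module.finrank F ↥(U ⊓ polar q U) = d → Module.finrank F U = d + r →
    (iso q U).card = isoCount q d r := by
  intro r
  induction r with
  | zero =>
    intro U h1 h2
    have : U ⊓ polar q U = U := Submodule.eq_of_le_of_finrank_eq inf_le_left (by omega)
    have h3 : TotallyIsotropic q U := (H.ti_iff U).2 (inf_eq_left.1 this)
    rw [H.card_iso_ti h3, h2]; rfl
  | succ r ih =>
    intro U h1 h2
    have h3 : ¬ TotallyIsotropic q U := by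
      intro h
      rw [H.ti_iff, ← inf_eq_left] at h
      rw [h] at h1; omega
    obtain ⟨y, hy, hyy⟩ := GoodField.exists_nonisotropic h3
    have h4 := finrank_sec hy hyy
    have h5 := H.iso_rec hy hyy
    have h6 := ih (sec q U y) (by rw [H.rad_sec hy hyy]; exact h1) (by omega)
    rw [h6] at h5
    have h7 : Module.finrank F (sec q U y) = d + r := by omega
    rw [h7] at h5
    simp only [isoCount]
    omega

lemma GoodField.card_iso_le (H : GoodField q F) (U : Submodule F (Fin m → F)) (k : ℕ)
    (hU : Module.finrank F U = k + 1) (h3 : ¬ TotallyIsotropic q U) :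
    (iso q U).card ≤ (q + 1) * q ^ (2 * k) := by
  obtain ⟨y, hy, hyy⟩ := GoodField.exists_nonisotropic h3
  have h4 := finrank_sec hy hyy
  have h5 := H.iso_rec hy hyy
  have : Module.finrank F (sec q U y) = k := by omega
  rw [this] at h5
  omega

/-- lower bound: rank at least two -/
lemma GoodField.card_iso_ge (H : GoodField q F) (U : Submodule F (Fin m → F)) (k : ℕ)
    (hU : Module.finrank F U = k + 2)
    (h3 : Module.finrank F ↥(U ⊓ polar q U) ≤ k) :
    q ^ (2 * k + 1) * (q ^ 2 - 1) ≤ (iso q U).card := by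
  have hq := H.two_le
  have h3' : ¬ TotallyIsotropic q U := by
    intro h
    rw [H.ti_iff, ← inf_eq_left] at h
    rw [h] at h3; omega
  obtain ⟨y, hy, hyy⟩ := GoodField.exists_nonisotropic h3'
  have h4 := finrank_sec hy hyy
  have h5 := H.iso_rec hy hyy
  have h7 : Module.finrank F (sec q U y) = k + 1 := by omega
  have h8 : ¬ TotallyIsotropic q (sec q U y) := by
    intro h
    rw [H.ti_iff, ← inf_eq_left, H.rad_sec hy hyy] at h
    rw [h] at h3; omega
  have h9 := H.card_iso_le _ k h7 h8
  rw [h7] at h5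
  have h10 : q * (iso q (sec q U y)).card ≤ q * ((q + 1) * q ^ (2 * k)) := Nat.mul_le_mul_left _ h9
  obtain ⟨j, rfl⟩ : ∃ j, q = j + 1 := ⟨q - 1, by omega⟩
  have e1 : (j + 1) ^ 2 - 1 = j * (j + 2) := by
    have : (j + 1) ^ 2 = j * (j + 2) + 1 := by ring
    omega
  rw [e1]
  have e2 : (j + 1 + 1) * (j + 1) ^ (2 * (k + 1)) =
    (j + 1) ^ (2 * k + 1) * (j * (j + 2)) + (j + 1) * ((j + 1 + 1) * (j + 1) ^ (2 * k)) := by ring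
  omega

lemma GoodField.card_iso_rank_one (H : GoodField q F) (U : Submodule F (Fin m → F)) (k : ℕ)
    (hU : Module.finrank F U = k + 1)
    (h3 : Module.finrank F ↥(U ⊓ polar q U) = k) :
    (iso q U).card = q ^ (2 * k) := by
  have := H.card_iso k 1 U h3 hU
  rw [this]
  simp only [isoCount, add_zero]
  rw [add_mul, one_mul]; omega

end Basic

section Gens

variable {q n : ℕ} {F : Type} [Field F] [Fintype F]

/-- The generators through a given subspace. -/
noncomputable def gens (q n : ℕ) {F : Type} [Field F] [Fintype F]
    (W : Submodule F (Fin (2*n+2) → F)) : Finset (Submodule F (Fin (2*n+2) → F)) :=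
  (Set.toFinite {μ | IsGenerator q n μ ∧ W ≤ μ}).toFinset

lemma mem_gens {W μ : Submodule F (Fin (2*n+2) → F)} :
    μ ∈ gens q n W ↔ IsGenerator q n μ ∧ W ≤ μ := by simp [gens]

lemma GoodField.ti_sup (H : GoodField q F) {m : ℕ} {W : Submodule F (Fin m → F)}
    (hW : TotallyIsotropic q W) {w : Fin m → F} (h1 : w ∈ polar q W) (h2 : herm q w w = 0) :
    TotallyIsotropic q (W ⊔ Submodule.span F {w}) := by
  intro x hx
  obtain ⟨a, ha, b, hb, rfl⟩ := Submodule.mem_sup.1 hx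
  obtain ⟨t, rfl⟩ := Submodule.mem_span_singleton.1 hb
  have h3 := mem_polar.1 h1 a ha
  have h4 := H.herm_comm_zero h3
  rw [herm_add_left, H.herm_add_right, H.herm_add_right, herm_smul_left, herm_smul_left,
      H.herm_smul_right, H.herm_smul_right, h3, h4, h2, hW a ha]
  ring

lemma GoodField.finrank_ti (H : GoodField q F) {W : Submodule F (Fin (2*n+2) → F)}
    (hW : TotallyIsotropic q W) : Module.finrank F W ≤ n + 1 := by
  have h1 := Submodule.finrank_mono ((H.ti_iff W).1 hW)
  have h2 := H.finrank_polar W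
  omega

open scoped Classical in
lemma GoodField.card_iso_diff (H : GoodField q F) {W : Submodule F (Fin (2*n+2) → F)}
    (hW : TotallyIsotropic q W) :
    ((iso q (polar q W)).filter (fun w => w ∉ W)).card + q ^ (2 * Module.finrank F W) =
      (iso q (polar q W)).card := by
  rw [← H.card_mem W, add_comm, ← Finset.card_filter_add_card_filter_not
    (s := iso q (polar q W)) (fun w => w ∈ W)]
  congr 2
  ext x
  simp only [Finset.mem_filter, Finset.mem_univ, true_and, mem_iso]
  exact ⟨fun hx => ⟨⟨(H.ti_iff W).1 hW hx, hW x hx⟩, hx⟩, fun h => h.2⟩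

open scoped Classical in
lemma GoodField.gens_step (H : GoodField q F) {W : Submodule F (Fin (2*n+2) → F)}
    (hW : TotallyIsotropic q W) :
    (gens q n W).card * (q ^ (2 * (n + 1)) - q ^ (2 * Module.finrank F W)) =
      ∑ w ∈ (iso q (polar q W)).filter (fun w => w ∉ W),
        (gens q n (W ⊔ Submodule.span F {w})).card := by
  have key := Finset.sum_card_bipartiteAbove_eq_sum_card_bipartiteBelow (s := gens q n W)
    (t := (iso q (polar q W)).filter (fun w => w ∉ W)) (fun μ w => w ∈ μ)
  have h1 : ∀ μ ∈ gens q n W, (Finset.bipartiteAbove (fun μ w => w ∈ μ)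
      ((iso q (polar q W)).filter (fun w => w ∉ W)) μ).card =
      (q ^ (2 * (n + 1)) - q ^ (2 * Module.finrank F W)) := by
    intro μ hμ
    obtain ⟨⟨hd, ht⟩, hle⟩ := mem_gens.1 hμ
    rw [← hd, ← H.card_mem μ, ← H.card_mem W, ← Finset.card_sdiff_of_subset]
    · congr 1
      ext x
      simp only [Finset.bipartiteAbove, Finset.mem_filter, mem_iso, Finset.mem_sdiff,
        Finset.mem_univ, true_and]
      constructor
      · rintro ⟨⟨_, h2⟩, h3⟩; exact ⟨h3, h2⟩
      · rintro ⟨h3, h2⟩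
        exact ⟨⟨⟨polar_anti hle ((H.ti_iff μ).1 ht h3), ht x h3⟩, h2⟩, h3⟩
    · intro x; simp only [Finset.mem_filter, Finset.mem_univ, true_and]; exact fun h => hle h
  have h2 : ∀ w ∈ (iso q (polar q W)).filter (fun w => w ∉ W),
      (Finset.bipartiteBelow (fun μ w => w ∈ μ) (gens q n W) w).card =
      (gens q n (W ⊔ Submodule.span F {w})).card := by
    intro w _
    congr 1
    ext μ
    simp only [Finset.bipartiteBelow, Finset.mem_filter, mem_gens, sup_le_iff,
      Submodule.span_singleton_le_iff_mem]
    tauto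
  rw [Finset.sum_congr rfl h1, Finset.sum_congr rfl h2, Finset.sum_const, smul_eq_mul] at key
  exact key

lemma GoodField.rad_polar (H : GoodField q F) {W : Submodule F (Fin (2*n+2) → F)}
    (hW : TotallyIsotropic q W) : polar q W ⊓ polar q (polar q W) = W := by
  rw [H.polar_polar]; exact inf_eq_right.2 ((H.ti_iff W).1 hW)

lemma GoodField.gens_const (H : GoodField q F) (k : ℕ) :
    ∀ W W' : Submodule F (Fin (2*n+2) → F), TotallyIsotropic q W → TotallyIsotropic q W' →
    Module.finrank F W + k = n + 1 → Module.finrank F W' + k = n + 1 →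
    (gens q n W).card = (gens q n W').card ∧ 0 < (gens q n W).card := by
  classical
  have hq := H.two_le
  induction k with
  | zero =>
    have : ∀ W : Submodule F (Fin (2*n+2) → F), TotallyIsotropic q W →
        Module.finrank F W + 0 = n + 1 → (gens q n W).card = 1 := by
      intro W hW hd
      rw [Finset.card_eq_one]
      refine ⟨W, ?_⟩
      ext μ
      rw [mem_gens, Finset.mem_singleton]
      constructor
      · rintro ⟨⟨h1, _⟩, h2⟩
        exact (Submodule.eq_of_le_of_finrank_eq h2 (by omega)).symm
      · rintro rfl; exact ⟨⟨hd, hW⟩, le_refl _⟩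
    intro W W' h1 h2 h3 h4
    rw [this W h1 h3, this W' h2 h4]; simp
  | succ k ih =>
    intro W W' h1 h2 h3 h4
    -- facts valid for both
    have fact : ∀ W : Submodule F (Fin (2*n+2) → F), TotallyIsotropic q W →
        Module.finrank F W + (k + 1) = n + 1 →
        ((iso q (polar q W)).filter (fun w => w ∉ W)).card +
          q ^ (2 * Module.finrank F W) = isoCount q (Module.finrank F W) (2 * (k + 1)) ∧
        0 < ((iso q (polar q W)).filter (fun w => w ∉ W)).card ∧
        ∀ w ∈ (iso q (polar q W)).filter (fun w => w ∉ W),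
          TotallyIsotropic q (W ⊔ Submodule.span F {w}) ∧
          Module.finrank F ↥(W ⊔ Submodule.span F {w}) + k = n + 1 := by
      intro W hW hd
      have e := H.card_iso_diff hW
      have hp := H.finrank_polar W
      refine ⟨?_, ?_, ?_⟩
      · rw [e]
        apply H.card_iso
        · rw [H.rad_polar hW]
        · omega
      · obtain ⟨j, hj⟩ : ∃ j, Module.finrank F (polar q W) = j + 2 :=
          ⟨Module.finrank F (polar q W) - 2, by omega⟩
        have h5 := H.card_iso_ge (polar q W) j hj (by rw [H.rad_polar hW]; omega)
        have h6 : q ^ (2 * Module.finrank F W) < q ^ (2 * j + 1) :=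
          Nat.pow_lt_pow_right (by omega) (by omega)
        have h7 : 1 ≤ q ^ 2 - 1 := by
          have : 2 ^ 2 ≤ q ^ 2 := Nat.pow_le_pow_left hq 2
          omega
        have h8 : q ^ (2 * j + 1) * 1 ≤ q ^ (2 * j + 1) * (q ^ 2 - 1) :=
          Nat.mul_le_mul_left _ h7
        omega
      · intro w hw
        simp only [Finset.mem_filter, mem_iso] at hw
        refine ⟨H.ti_sup hW hw.1.1 hw.1.2, ?_⟩
        rw [Submodule.finrank_sup_span_singleton hw.2]; omega
    obtain ⟨a1, a2, a3⟩ := fact W h1 h3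
    obtain ⟨b1, b2, b3⟩ := fact W' h2 h4
    have hfr : Module.finrank F W = Module.finrank F W' := by omega
    obtain ⟨w0, hw0⟩ := Finset.card_pos.1 a2
    obtain ⟨c1, c2⟩ := a3 w0 hw0
    have s1 := H.gens_step h1
    have s2 := H.gens_step h2
    rw [Finset.sum_congr rfl (fun w hw => (ih _ _ (a3 w hw).1 c1 (a3 w hw).2 c2).1),
      Finset.sum_const, smul_eq_mul] at s1
    rw [Finset.sum_congr rfl (fun w hw => (ih _ _ (b3 w hw).1 c1 (b3 w hw).2 c2).1),
      Finset.sum_const, smul_eq_mul] at s2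
    have hpos := (ih _ _ c1 c1 c2 c2).2
    have hcc : ((iso q (polar q W)).filter (fun w => w ∉ W)).card =
        ((iso q (polar q W')).filter (fun w => w ∉ W')).card := by
      rw [hfr] at a1; omega
    have hD : 0 < q ^ (2 * (n + 1)) - q ^ (2 * Module.finrank F W) := by
      have : q ^ (2 * Module.finrank F W) < q ^ (2 * (n + 1)) :=
        Nat.pow_lt_pow_right (by omega) (by omega)
      omega
    constructor
    · apply Nat.eq_of_mul_eq_mul_right hD
      rw [s1, hcc, ← s2, hfr]
    · have : 0 < (gens q n W).card * (q ^ (2 * (n + 1)) - q ^ (2 * Module.finrank F W)) := by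
        rw [s1]; positivity
      exact Nat.pos_of_mul_pos_right this

lemma arith_nbr (n q : ℕ) (hn : 2 ≤ n) (hq : 2 ≤ q) (K a : ℝ) (hK : 8 * K ≤ q) (hK0 : 0 ≤ K)
    (ha : 0 ≤ a)
    (h : ((q:ℝ) ^ (4 * n - 1) * ((q:ℝ) ^ 2 - 1) - (q:ℝ) ^ 2) * ((q:ℝ) ^ 4 - (q:ℝ) ^ 2) ≤
      (q:ℝ) ^ (2 * n + 2) * ((q:ℝ) ^ 2 * a + K * (q:ℝ) ^ (2 * n + 2))) :
    (q:ℝ) ^ (2 * n + 1) / 8 ≤ a := by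
  have hq' : (2:ℝ) ≤ q := by exact_mod_cast hq
  obtain ⟨k, rfl⟩ : ∃ k, n = k + 1 := ⟨n - 1, by omega⟩
  set x : ℝ := (q:ℝ) with hx
  have e0 : 4 * (k + 1) - 1 = 4 * k + 3 := by omega
  rw [e0] at h
  have hz : 1 ≤ x ^ (2 * k) := one_le_pow₀ (by linarith)
  set z : ℝ := x ^ (2 * k) with hzdef
  have e1 : x ^ (4 * k + 3) = z ^ 2 * x ^ 3 := by rw [hzdef]; ring
  have e2 : x ^ (2 * (k + 1) + 2) = z * x ^ 4 := by rw [hzdef]; ring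
  have e3 : x ^ (2 * (k + 1) + 1) = z * x ^ 3 := by rw [hzdef]; ring
  rw [e1, e2] at h
  rw [e3]
  have hx2 : 4 ≤ x ^ 2 := by nlinarith
  have hx3 : 8 ≤ x ^ 3 := by nlinarith
  have hzz : 1 ≤ z ^ 2 := by nlinarith
  -- lower bounds
  have l1 : z ^ 2 * x ^ 5 / 2 ≤ z ^ 2 * x ^ 3 * (x ^ 2 - 1) - x ^ 2 := by
    have t1 : x ^ 2 ≤ z ^ 2 * x ^ 2 := by nlinarith
    have t2 : 0 ≤ z ^ 2 * x ^ 2 * (x ^ 3 / 2 - x - 1) := by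
      apply mul_nonneg (by positivity)
      nlinarith
    nlinarith
  have l2 : x ^ 4 / 2 ≤ x ^ 4 - x ^ 2 := by nlinarith
  have l3 : (z ^ 2 * x ^ 5 / 2) * (x ^ 4 / 2) ≤
      (z ^ 2 * x ^ 3 * (x ^ 2 - 1) - x ^ 2) * (x ^ 4 - x ^ 2) :=
    mul_le_mul l1 l2 (by positivity) (le_trans (by positivity) l1)
  have l4 := l3.trans h
  have l5 : (z * x ^ 6) * (z * x ^ 3 / 4) ≤ (z * x ^ 6) * (a + K * (z * x ^ 2)) := by
    nlinarith
  have l6 := le_of_mul_le_mul_left l5 (by positivity)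
  have l7 : K * (z * x ^ 2) ≤ x / 8 * (z * x ^ 2) :=
    mul_le_mul_of_nonneg_right (by linarith) (by positivity)
  nlinarith

open scoped Classical in
lemma GoodField.swap_le (H : GoodField q F) {v : Fin (2*n+2) → F}
    (f2 : ℕ) (hf2 : ∀ w : Fin (2*n+2) → F, w ∉ Submodule.span F {v} → herm q w v = 0 →
      herm q w w = 0 → (gens q n (Submodule.span F {v} ⊔ Submodule.span F {w})).card = f2)
    (B : Finset (Fin (2*n+2) → F)) :
    ∑ μ ∈ gens q n (Submodule.span F {v}),
      (B.filter (fun w => w ∉ Submodule.span F {v} ∧ w ∈ μ)).card ≤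
      (B.filter (fun w => herm q w v = 0)).card * f2 := by
  have key := Finset.sum_card_bipartiteAbove_eq_sum_card_bipartiteBelow
    (s := gens q n (Submodule.span F {v})) (t := B)
    (fun μ w => w ∉ Submodule.span F {v} ∧ w ∈ μ)
  unfold Finset.bipartiteAbove at key
  have hc : (B.filter (fun w => herm q w v = 0)).card * f2 =
      ∑ w ∈ B, if herm q w v = 0 then f2 else 0 := by
    rw [← Finset.sum_filter, Finset.sum_const, smul_eq_mul]
  rw [key, hc]
  refine Finset.sum_le_sum fun w _ => ?_
  by_cases hne : (Finset.bipartiteBelow (fun μ w => w ∉ Submodule.span F {v} ∧ w ∈ μ)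
      (gens q n (Submodule.span F {v})) w).Nonempty
  · obtain ⟨μ, hμ⟩ := hne
    simp only [Finset.bipartiteBelow, Finset.mem_filter, mem_gens] at hμ
    obtain ⟨⟨⟨hd, ht⟩, hle⟩, hw, hwμ⟩ := hμ
    have hv : v ∈ μ := hle (Submodule.mem_span_singleton_self v)
    have h1 : herm q w v = 0 := mem_polar.1 ((H.ti_iff μ).1 ht hwμ) v hv
    rw [if_pos h1, ← hf2 w hw h1 (ht w hwμ)]
    apply Finset.card_le_card
    intro ν hν
    simp only [Finset.bipartiteBelow, Finset.mem_filter, mem_gens] at hν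
    rw [mem_gens, sup_le_iff, Submodule.span_singleton_le_iff_mem (m := w)]
    exact ⟨hν.1.1, hν.1.2, hν.2.2⟩
  · rw [Finset.not_nonempty_iff_eq_empty] at hne
    rw [hne]; simp

open scoped Classical in
lemma GoodField.nbr (H : GoodField q F) (hn : 2 ≤ n) {v : Fin (2*n+2) → F} (hv0 : v ≠ 0)
    (hvv : herm q v v = 0) (A : Finset (Fin (2*n+2) → F))
    (G : Finset (Submodule F (Fin (2*n+2) → F))) (hG : ∀ π ∈ G, IsGenerator q n π)
    (hA : ∀ w ∈ A, ∀ a : F, a ≠ 0 → a • w ∈ A)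
    (hmeet : ∀ μ ∈ gens q n (Submodule.span F {v}), ∃ w ∈ μ, w ∉ Submodule.span F {v} ∧
      (w ∈ A ∨ ∃ π ∈ G, w ∈ π))
    (hqG : 8 * (G.card : ℝ) ≤ q) :
    (q:ℝ) ^ (2 * n + 1) / 8 ≤ ((A.filter (fun w => herm q w v = 0)).card : ℝ) := by
  have hq := H.two_le
  set P := Submodule.span F {v} with hP
  have hPd : Module.finrank F P = 1 := finrank_span_singleton hv0
  have hPt : TotallyIsotropic q P := by
    intro x hx
    obtain ⟨t, rfl⟩ := Submodule.mem_span_singleton.1 hx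
    rw [herm_smul_left, H.herm_smul_right, hvv]; ring
  have hmemP : ∀ w, w ∈ polar q P ↔ herm q w v = 0 := by
    intro w
    rw [mem_polar]
    constructor
    · intro h; exact h v (Submodule.mem_span_singleton_self v)
    · intro h x hx
      obtain ⟨t, rfl⟩ := Submodule.mem_span_singleton.1 hx
      rw [H.herm_smul_right, h, mul_zero]
  have hpd := H.finrank_polar P
  -- isotropic vectors in the polar of P
  have hiso := H.card_iso_ge (polar q P) (2 * n - 1) (by omega)
    (by rw [H.rad_polar hPt, hPd]; omega)
  have e := H.card_iso_diff hPt
  rw [hPd] at e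
  have hline : ∀ w ∈ (iso q (polar q P)).filter (fun w => w ∉ P),
      TotallyIsotropic q (P ⊔ Submodule.span F {w}) ∧
      Module.finrank F ↥(P ⊔ Submodule.span F {w}) + (n - 1) = n + 1 := by
    intro w hw
    simp only [Finset.mem_filter, mem_iso] at hw
    refine ⟨H.ti_sup hPt hw.1.1 hw.1.2, ?_⟩
    rw [Submodule.finrank_sup_span_singleton hw.2]; omega
  have hpos : 0 < ((iso q (polar q P)).filter (fun w => w ∉ P)).card := by
    have h6 : q ^ (2 * 1) < q ^ (2 * (2 * n - 1) + 1) :=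
      Nat.pow_lt_pow_right (by omega) (by omega)
    have h7 : 1 ≤ q ^ 2 - 1 := by
      have : 2 ^ 2 ≤ q ^ 2 := Nat.pow_le_pow_left hq 2
      omega
    have h8 : q ^ (2 * (2 * n - 1) + 1) * 1 ≤ q ^ (2 * (2 * n - 1) + 1) * (q ^ 2 - 1) :=
      Nat.mul_le_mul_left _ h7
    omega
  obtain ⟨w0, hw0⟩ := Finset.card_pos.1 hpos
  obtain ⟨c1, c2⟩ := hline w0 hw0
  set f2 := (gens q n (P ⊔ Submodule.span F {w0})).card with hf2def
  have hf2pos : 0 < f2 := (H.gens_const (n - 1) _ _ c1 c1 c2 c2).2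
  have hf2 : ∀ w : Fin (2*n+2) → F, w ∉ P → herm q w v = 0 →
      herm q w w = 0 → (gens q n (P ⊔ Submodule.span F {w})).card = f2 := by
    intro w h1 h2 h3
    have hw : w ∈ (iso q (polar q P)).filter (fun w => w ∉ P) := by
      simp only [Finset.mem_filter, mem_iso]
      exact ⟨⟨(hmemP w).2 h2, h3⟩, h1⟩
    exact (H.gens_const (n - 1) _ _ (hline w hw).1 c1 (hline w hw).2 c2).1
  have s1 := H.gens_step hPt
  rw [Finset.sum_congr rfl (fun w hw => by
    simp only [Finset.mem_filter, mem_iso] at hw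
    exact hf2 w hw.2 ((hmemP w).1 hw.1.1) hw.1.2), Finset.sum_const, smul_eq_mul, hPd] at s1
  set f1 := (gens q n P).card with hf1def
  -- upper bound on f1
  let X : Submodule F (Fin (2*n+2) → F) → Submodule F (Fin (2*n+2) → F) :=
    fun π => (π ⊓ polar q P) ⊔ P
  have hX : ∀ π ∈ G, (Finset.univ.filter (fun x => x ∈ X π)).card ≤ q ^ (2 * n + 2) := by
    intro π hπ
    rw [H.card_mem]
    apply Nat.pow_le_pow_right (by omega)
    have h1 : TotallyIsotropic q (X π) := by
      apply H.ti_sup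
      · intro x hx; exact (hG π hπ).2 x hx.1
      · rw [mem_polar]
        intro x hx
        exact H.herm_comm_zero ((hmemP x).1 hx.2)
      · exact hvv
    have := H.finrank_ti h1
    omega
  have hmu : ∀ μ ∈ gens q n P, q ^ 4 - q ^ 2 ≤
      q ^ 2 * (A.filter (fun w => w ∉ P ∧ w ∈ μ)).card +
      ∑ π ∈ G, ((Finset.univ.filter (fun x => x ∈ X π)).filter (fun w => w ∉ P ∧ w ∈ μ)).card := by
    intro μ hμ
    obtain ⟨w, hwμ, hwP, hor⟩ := hmeet μ hμ
    obtain ⟨⟨hd, ht⟩, hle⟩ := mem_gens.1 hμ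
    rcases hor with hwA | ⟨π, hπ, hwπ⟩
    · have hw0 : w ≠ 0 := by rintro rfl; exact hwP P.zero_mem
      have : q ^ 2 - 1 ≤ (A.filter (fun w => w ∉ P ∧ w ∈ μ)).card := by
        have hc : ((Finset.univ.filter (fun a : F => a ≠ 0)).image (fun a => a • w)).card =
            q ^ 2 - 1 := by
          rw [Finset.card_image_of_injective _ (smul_left_injective F hw0), Finset.filter_ne',
            Finset.card_erase_of_mem (Finset.mem_univ _), Finset.card_univ, H.card]
        rw [← hc]
        apply Finset.card_le_card
        intro x hx
        simp only [Finset.mem_image, Finset.mem_filter, Finset.mem_univ, true_and] at hx ⊢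
        obtain ⟨a, ha, rfl⟩ := hx
        refine ⟨hA w hwA a ha, ?_, μ.smul_mem _ hwμ⟩
        rwa [P.smul_mem_iff ha]
      have h2 : q ^ 2 * (q ^ 2 - 1) ≤ q ^ 2 * (A.filter (fun w => w ∉ P ∧ w ∈ μ)).card :=
        Nat.mul_le_mul_left _ this
      have h3 : q ^ 2 * (q ^ 2 - 1) = q ^ 4 - q ^ 2 := by
        rw [Nat.mul_sub, ← pow_add]; simp
      omega
    · have h4 : q ^ 4 - q ^ 2 ≤
          ((Finset.univ.filter (fun x => x ∈ X π)).filter (fun w => w ∉ P ∧ w ∈ μ)).card := by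
        have hc1 := H.card_mem (P ⊔ Submodule.span F {w})
        rw [Submodule.finrank_sup_span_singleton hwP, hPd] at hc1
        have hc2 := H.card_mem P
        rw [hPd] at hc2
        have e1 : q ^ 4 = q ^ (2 * (1 + 1)) := by norm_num
        have e2 : q ^ 2 = q ^ (2 * 1) := by norm_num
        rw [e1, e2, ← hc1, ← hc2]
        refine (Finset.le_card_sdiff _ _).trans (Finset.card_le_card ?_)
        intro x hx
        simp only [Finset.mem_sdiff, Finset.mem_filter, Finset.mem_univ, true_and] at hx ⊢
        refine ⟨?_, hx.2, ?_⟩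
        · have : P ⊔ Submodule.span F {w} ≤ X π := by
            refine sup_le le_sup_right ?_
            rw [Submodule.span_singleton_le_iff_mem]
            refine Submodule.mem_sup_left ⟨hwπ, ?_⟩
            exact polar_anti hle ((H.ti_iff μ).1 ht hwμ)
          exact this hx.1
        · have : P ⊔ Submodule.span F {w} ≤ μ := by
            refine sup_le hle ?_
            rwa [Submodule.span_singleton_le_iff_mem]
          exact this hx.1
      have h5 := Finset.single_le_sum (f := fun π => ((Finset.univ.filter (fun x => x ∈ X π)).filter
        (fun w => w ∉ P ∧ w ∈ μ)).card) (fun _ _ => Nat.zero_le _) hπ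
      exact (h4.trans h5).trans (Nat.le_add_left _ _)
  have hsum := Finset.sum_le_sum hmu
  rw [Finset.sum_const, smul_eq_mul, Finset.sum_add_distrib, ← Finset.mul_sum,
    Finset.sum_comm, ← hf1def] at hsum
  have hb1 := H.swap_le f2 hf2 A
  have hb2 : ∑ π ∈ G, ∑ μ ∈ gens q n P, ((Finset.univ.filter (fun x => x ∈ X π)).filter
        (fun w => w ∉ P ∧ w ∈ μ)).card ≤ G.card * (q ^ (2 * n + 2) * f2) := by
    refine Finset.sum_le_card_nsmul _ _ _ fun π hπ => ?_
    refine (H.swap_le f2 hf2 _).trans (Nat.mul_le_mul_right _ ?_)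
    exact (Finset.card_le_card (Finset.filter_subset _ _)).trans (hX π hπ)
  set a := (A.filter (fun w => herm q w v = 0)).card with hadef
  set K := G.card with hKdef
  have hf : f1 * (q ^ 4 - q ^ 2) ≤ f2 * (q ^ 2 * a + K * q ^ (2 * n + 2)) := by
    calc _ ≤ _ := hsum
      _ ≤ q ^ 2 * (a * f2) + K * (q ^ (2 * n + 2) * f2) :=
        Nat.add_le_add (Nat.mul_le_mul_left _ hb1) hb2
      _ = _ := by ring
  have e4 : 2 * (2 * n - 1) + 1 = 4 * n - 1 := by omega
  rw [e4] at hiso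
  set D := ((iso q (polar q P)).filter (fun w => w ∉ P)).card with hDdef
  rw [← e] at hiso
  -- D * f2 * (q^4 - q^2) ≤ q^(2n+2) * f2 * (...)
  have hg : D * (q ^ 4 - q ^ 2) ≤ q ^ (2 * n + 2) * (q ^ 2 * a + K * q ^ (2 * n + 2)) := by
    apply Nat.le_of_mul_le_mul_left _ hf2pos
    calc f2 * (D * (q ^ 4 - q ^ 2)) = (D * f2) * (q ^ 4 - q ^ 2) := by ring
      _ = f1 * (q ^ (2 * (n + 1)) - q ^ (2 * 1)) * (q ^ 4 - q ^ 2) := by rw [s1]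
      _ ≤ f1 * q ^ (2 * (n + 1)) * (q ^ 4 - q ^ 2) := by
        gcongr; exact Nat.sub_le _ _
      _ = q ^ (2 * n + 2) * (f1 * (q ^ 4 - q ^ 2)) := by ring
      _ ≤ q ^ (2 * n + 2) * (f2 * (q ^ 2 * a + K * q ^ (2 * n + 2))) :=
        Nat.mul_le_mul_left _ hf
      _ = _ := by ring
  apply arith_nbr n q hn hq K a hqG (by positivity) (by positivity)
  have q1 : 1 ≤ q ^ 2 := Nat.one_le_pow _ _ (by omega)
  have q2 : q ^ 2 ≤ q ^ 4 := Nat.pow_le_pow_right (by omega) (by omega)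
  have r1 : (q:ℝ) ^ (4 * n - 1) * ((q:ℝ) ^ 2 - 1) ≤ D + (q:ℝ) ^ 2 := by
    have := (Nat.cast_le (α := ℝ)).2 hiso
    push_cast [Nat.cast_sub q1] at this
    simpa using this
  have r2 : (D:ℝ) * ((q:ℝ) ^ 4 - (q:ℝ) ^ 2) ≤
      (q:ℝ) ^ (2 * n + 2) * ((q:ℝ) ^ 2 * a + K * (q:ℝ) ^ (2 * n + 2)) := by
    have := (Nat.cast_le (α := ℝ)).2 hg
    push_cast [Nat.cast_sub q2] at this
    exact this
  refine le_trans (mul_le_mul_of_nonneg_right (by linarith) ?_) r2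
  have : (q:ℝ) ^ 2 ≤ (q:ℝ) ^ 4 := by exact_mod_cast q2
  linarith

end Gens

section Graph

variable {q n : ℕ} {F : Type} [Field F] [Fintype F]

open scoped Classical in
lemma GoodField.greedy (H : GoodField q F) (T : Finset (Fin (2*n+2) → F)) (κ δ M : ℝ)
    (hκ : 0 < κ) (hδ : 0 < δ) (hM : 0 < M) (hT : (T.card : ℝ) ≤ δ * M)
    (hTpos : κ * M ≤ T.card)
    (hdeg : ∀ v ∈ T, κ * M ≤ ((T.filter (fun w => herm q w v = 0)).card : ℝ))
    (hno : ∀ U : Submodule F (Fin (2*n+2) → F), Module.finrank F U ≤ n + 1 →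
      ((T.filter (fun w => w ∈ U)).card : ℝ) ≤ κ / 2 * M) (j : ℕ) (hj : j ≤ n + 2) :
    ∃ X : Submodule F (Fin (2*n+2) → F), Module.finrank F X = j ∧
      κ * (κ / (2 * δ)) ^ j * M ≤ ((T.filter (fun w => w ∈ polar q X)).card : ℝ) := by
  induction j with
  | zero =>
    refine ⟨⊥, by simp, ?_⟩
    have : T.filter (fun w => w ∈ polar q (⊥ : Submodule F (Fin (2*n+2) → F))) = T := by
      apply Finset.filter_true_of_mem
      intro w _
      rw [mem_polar]
      intro x hx
      rw [(Submodule.mem_bot F).1 hx]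
      have : q ≠ 0 := by have := H.two_le; omega
      simp [herm, this]
    rw [this]; simpa using hTpos
  | succ j ih =>
    obtain ⟨X, hX, hA⟩ := ih (by omega)
    set A := T.filter (fun w => w ∈ polar q X) with hAdef
    set B := T.filter (fun w => w ∉ X) with hBdef
    have hApos : 0 < (A.card : ℝ) := lt_of_lt_of_le (by positivity) hA
    have hy : ∀ y ∈ A, κ / 2 * M ≤ ((B.filter (fun x => herm q x y = 0)).card : ℝ) := by
      intro y hy
      have h1 := hdeg y (Finset.mem_filter.1 hy).1
      have h2 := hno X (by omega)
      have h3 : (T.filter (fun w => herm q w y = 0)).card ≤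
          (T.filter (fun w => w ∈ X)).card + (B.filter (fun x => herm q x y = 0)).card := by
        rw [← Finset.card_filter_add_card_filter_not (s := T.filter (fun w => herm q w y = 0))
          (fun w => w ∈ X)]
        apply Nat.add_le_add
        · apply Finset.card_le_card
          intro x; simp only [Finset.mem_filter]; tauto
        · apply Finset.card_le_card
          intro x; simp only [hBdef, Finset.mem_filter]; tauto
      have h4 : ((T.filter (fun w => herm q w y = 0)).card : ℝ) ≤
          (T.filter (fun w => w ∈ X)).card + (B.filter (fun x => herm q x y = 0)).card := by
        exact_mod_cast h3
      linarith
    have hBne : B.Nonempty := by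
      obtain ⟨y, hyA⟩ := Finset.card_pos.1 (Nat.cast_pos.1 hApos)
      have h1 := hy y hyA
      have h2 : 0 < ((B.filter (fun x => herm q x y = 0)).card : ℝ) :=
        lt_of_lt_of_le (by positivity) h1
      obtain ⟨x, hx⟩ := Finset.card_pos.1 (Nat.cast_pos.1 h2)
      exact ⟨x, (Finset.mem_filter.1 hx).1⟩
    have key := Finset.sum_card_bipartiteAbove_eq_sum_card_bipartiteBelow
      (s := A) (t := B) (fun y x => herm q x y = 0)
    have hex : ∃ x ∈ B, κ / (2 * δ) * A.card ≤
        ((A.filter (fun y => herm q x y = 0)).card : ℝ) := by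
      by_contra hcon
      push Not at hcon
      have l1 := Finset.sum_lt_sum_of_nonempty hBne hcon
      have l2 := Finset.sum_le_sum hy
      rw [Finset.sum_const, nsmul_eq_mul] at l1 l2
      have l3 : (∑ y ∈ A, ((B.filter (fun x => herm q x y = 0)).card : ℝ)) =
          ∑ x ∈ B, ((A.filter (fun y => herm q x y = 0)).card : ℝ) := by
        exact_mod_cast key
      have l4 : (B.card : ℝ) ≤ δ * M := by
        refine le_trans ?_ hT
        exact_mod_cast Finset.card_le_card (Finset.filter_subset _ _)
      have l5 : (B.card : ℝ) * (κ / (2 * δ) * A.card) ≤ δ * M * (κ / (2 * δ) * A.card) :=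
        mul_le_mul_of_nonneg_right l4 (by positivity)
      have l6 : δ * M * (κ / (2 * δ) * A.card) = A.card * (κ / 2 * M) := by
        field_simp
      linarith
    obtain ⟨x, hxB, hx⟩ := hex
    refine ⟨X ⊔ Submodule.span F {x}, ?_, ?_⟩
    · rw [Submodule.finrank_sup_span_singleton (Finset.mem_filter.1 hxB).2, hX]
    · have h1 : A.filter (fun y => herm q x y = 0) ⊆
          T.filter (fun w => w ∈ polar q (X ⊔ Submodule.span F {x})) := by
        intro y hy
        simp only [hAdef, Finset.mem_filter] at hy ⊢
        refine ⟨hy.1.1, ?_⟩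
        rw [mem_polar]
        intro z hz
        obtain ⟨a, ha, b, hb, rfl⟩ := Submodule.mem_sup.1 hz
        obtain ⟨t, rfl⟩ := Submodule.mem_span_singleton.1 hb
        rw [H.herm_add_right, H.herm_smul_right, mem_polar.1 hy.1.2 a ha,
          H.herm_comm_zero hy.2]
        ring
      have h2 : ((A.filter (fun y => herm q x y = 0)).card : ℝ) ≤
          (T.filter (fun w => w ∈ polar q (X ⊔ Submodule.span F {x}))).card := by
        exact_mod_cast Finset.card_le_card h1
      refine le_trans ?_ (hx.trans h2)
      calc κ * (κ / (2 * δ)) ^ (j + 1) * M = κ / (2 * δ) * (κ * (κ / (2 * δ)) ^ j * M) := by ring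
        _ ≤ _ := mul_le_mul_of_nonneg_left hA (by positivity)

open scoped Classical in
lemma GoodField.exists_dense (H : GoodField q F) (T : Finset (Fin (2*n+2) → F)) (κ δ : ℝ)
    (hκ : 0 < κ) (hδ : 0 < δ) (hT : (T.card : ℝ) ≤ δ * (q:ℝ) ^ (2 * n + 1))
    (hTpos : κ * (q:ℝ) ^ (2 * n + 1) ≤ T.card)
    (hdeg : ∀ v ∈ T, κ * (q:ℝ) ^ (2 * n + 1) ≤
      ((T.filter (fun w => herm q w v = 0)).card : ℝ))
    (hqc : 1 < κ * (κ / (2 * δ)) ^ (n + 2) * q) :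
    ∃ U : Submodule F (Fin (2*n+2) → F), Module.finrank F U ≤ n + 1 ∧
      κ / 2 * (q:ℝ) ^ (2 * n + 1) < ((T.filter (fun w => w ∈ U)).card : ℝ) := by
  by_contra hcon
  push Not at hcon
  have hq := H.two_le
  have hq0 : (0:ℝ) < q := by exact_mod_cast (by omega : 0 < q)
  obtain ⟨X, hX, hc⟩ := H.greedy T κ δ _ hκ hδ (by positivity) hT hTpos hdeg hcon (n + 2) le_rfl
  have h1 : (T.filter (fun w => w ∈ polar q X)).card ≤ q ^ (2 * n) := by
    refine (Finset.card_le_card (Finset.filter_subset_filter _ (Finset.subset_univ T))).trans ?_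
    rw [H.card_mem]
    have := H.finrank_polar X
    exact Nat.pow_le_pow_right (by omega) (by omega)
  have h2 : ((T.filter (fun w => w ∈ polar q X)).card : ℝ) ≤ (q:ℝ) ^ (2 * n) := by
    exact_mod_cast h1
  have h3 : (q:ℝ) ^ (2 * n + 1) = q * (q:ℝ) ^ (2 * n) := by ring
  rw [h3] at hc
  have h4 : (0:ℝ) < (q:ℝ) ^ (2 * n) := by positivity
  nlinarith

open scoped Classical in
lemma GoodField.rich_union (H : GoodField q F) (S : Finset (Fin (2*n+2) → F)) (e : ℝ)
    (G : Finset (Submodule F (Fin (2*n+2) → F))) (hG : ∀ π ∈ G, Module.finrank F π = n + 1)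
    (hr : ∀ π ∈ G, e ≤ ((S.filter (fun w => w ∈ π)).card : ℝ)) :
    G.card * e - (G.card : ℝ) ^ 2 * (q:ℝ) ^ (2 * n) ≤
      ((S.filter (fun w => ∃ π ∈ G, w ∈ π)).card : ℝ) := by
  have hq := H.two_le
  induction G using Finset.induction_on with
  | empty => simp
  | insert μ G hμ ih =>
    have ih := ih (fun π hπ => hG π (Finset.mem_insert_of_mem hπ))
      (fun π hπ => hr π (Finset.mem_insert_of_mem hπ))
    have hm := hr μ (Finset.mem_insert_self _ _)
    have hun : S.filter (fun w => ∃ π ∈ insert μ G, w ∈ π) =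
        S.filter (fun w => w ∈ μ) ∪ S.filter (fun w => ∃ π ∈ G, w ∈ π) := by
      ext x
      simp only [Finset.mem_filter, Finset.mem_union, Finset.exists_mem_insert]
      tauto
    have hin : (S.filter (fun w => w ∈ μ) ∩ S.filter (fun w => ∃ π ∈ G, w ∈ π)).card ≤
        G.card * q ^ (2 * n) := by
      have hsub : (S.filter (fun w => w ∈ μ) ∩ S.filter (fun w => ∃ π ∈ G, w ∈ π)) ⊆
          G.biUnion (fun π => Finset.univ.filter (fun w => w ∈ μ ⊓ π)) := by
        intro x hx
        simp only [Finset.mem_inter, Finset.mem_filter] at hx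
        obtain ⟨⟨_, h1⟩, _, π, hπ, h2⟩ := hx
        rw [Finset.mem_biUnion]
        exact ⟨π, hπ, by simp [h1, h2]⟩
      refine (Finset.card_le_card hsub).trans (Finset.card_biUnion_le_card_mul _ _ _ ?_)
      intro π hπ
      rw [H.card_mem]
      apply Nat.pow_le_pow_right (by omega)
      have h1 := hG π (Finset.mem_insert_of_mem hπ)
      have h2 := hG μ (Finset.mem_insert_self _ _)
      have h3 : Module.finrank F ↥(μ ⊓ π) < Module.finrank F μ := by
        apply Submodule.finrank_lt_finrank_of_lt
        refine lt_of_le_of_ne inf_le_left fun h => ?_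
        have h4 : μ ≤ π := inf_eq_left.1 h
        have := Submodule.eq_of_le_of_finrank_eq h4 (by omega)
        exact hμ (this ▸ hπ)
      omega
    have hcu := Finset.card_union_add_card_inter (S.filter (fun w => w ∈ μ))
      (S.filter (fun w => ∃ π ∈ G, w ∈ π))
    rw [hun, Finset.card_insert_of_notMem hμ]
    have hcu' : ((S.filter (fun w => w ∈ μ) ∪ S.filter (fun w => ∃ π ∈ G, w ∈ π)).card : ℝ) +
      (S.filter (fun w => w ∈ μ) ∩ S.filter (fun w => ∃ π ∈ G, w ∈ π)).card =
      (S.filter (fun w => w ∈ μ)).card + (S.filter (fun w => ∃ π ∈ G, w ∈ π)).card := by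
      exact_mod_cast hcu
    have hin' : ((S.filter (fun w => w ∈ μ) ∩ S.filter (fun w => ∃ π ∈ G, w ∈ π)).card : ℝ) ≤
        G.card * (q:ℝ) ^ (2 * n) := by exact_mod_cast hin
    push_cast
    have hpos : (0:ℝ) ≤ (G.card : ℝ) * (q:ℝ) ^ (2 * n) := by positivity
    have hpos' : (0:ℝ) ≤ (q:ℝ) ^ (2 * n) := by positivity
    nlinarith

open scoped Classical in
lemma GoodField.rich_bound (H : GoodField q F) (S : Finset (Fin (2*n+2) → F)) (ε δ : ℝ)
    (hδ : 0 < δ) (hS : (S.card : ℝ) ≤ δ * (q:ℝ) ^ (2 * n + 1))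
    (G : Finset (Submodule F (Fin (2*n+2) → F))) (hG : ∀ π ∈ G, Module.finrank F π = n + 1)
    (hr : ∀ π ∈ G, ε * (q:ℝ) ^ (2 * n + 1) ≤ ((S.filter (fun w => w ∈ π)).card : ℝ))
    (K : ℕ) (hK : 2 * δ ≤ K * ε) (hqK : (K:ℝ) ^ 2 < δ * q) : G.card ≤ K := by
  by_contra hcon
  push Not at hcon
  obtain ⟨G', hsub, hcard⟩ := Finset.exists_subset_card_eq hcon.le
  have h1 := H.rich_union S _ G' (fun π h => hG π (hsub h)) (fun π h => hr π (hsub h))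
  have h2 : ((S.filter (fun w => ∃ π ∈ G', w ∈ π)).card : ℝ) ≤ S.card := by
    exact_mod_cast Finset.card_le_card (Finset.filter_subset _ _)
  rw [hcard] at h1
  have hq := H.two_le
  have hq0 : (0:ℝ) < q := by exact_mod_cast (by omega : 0 < q)
  have h4 : (0:ℝ) < (q:ℝ) ^ (2 * n) := by positivity
  have h3 : (q:ℝ) ^ (2 * n + 1) = q * (q:ℝ) ^ (2 * n) := by ring
  rw [h3] at h1 hS
  set z := (q:ℝ) ^ (2 * n)
  have h5 : 2 * δ * (q * z) ≤ K * ε * (q * z) := mul_le_mul_of_nonneg_right hK (by positivity)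
  have h6 : (K:ℝ) ^ 2 * z < δ * q * z := mul_lt_mul_of_pos_right hqK h4
  nlinarith

open scoped Classical in
lemma GoodField.convert (H : GoodField q F) {m : ℕ} (R : Submodule F (Fin m → F) → Prop)
    (hR : ∀ P, R P → Module.finrank F P = 1) (A : Finset (Fin m → F))
    (hA : ∀ v, v ∈ A ↔ v ≠ 0 ∧ R (Submodule.span F {v})) :
    A.card = Nat.card {P // R P} * (q ^ 2 - 1) := by
  have hfin : {P | R P}.Finite := Set.toFinite _
  have h1 : Nat.card {P // R P} = hfin.toFinset.card := Nat.card_eq_card_finite_toFinset hfin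
  rw [h1, Finset.card_eq_sum_card_fiberwise (t := hfin.toFinset)
    (f := fun v => Submodule.span F {v})]
  · apply Finset.sum_const_nat
    intro P hP
    have hRP : R P := by simpa using hP
    have hd := hR P hRP
    have hc := H.card_mem P
    rw [hd, mul_one] at hc
    rw [← hc, ← Finset.card_erase_of_mem (a := (0 : Fin m → F)) (by simp)]
    congr 1
    ext v
    simp only [Finset.mem_filter, Finset.mem_univ, true_and, Finset.mem_erase, hA]
    constructor
    · rintro ⟨⟨h0, _⟩, rfl⟩
      exact ⟨h0, Submodule.mem_span_singleton_self v⟩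
    · rintro ⟨h0, hv⟩
      have : Submodule.span F {v} = P := by
        apply Submodule.eq_of_le_of_finrank_eq
        · rwa [Submodule.span_singleton_le_iff_mem]
        · rw [hd, finrank_span_singleton h0]
      rw [this]; exact ⟨⟨h0, hRP⟩, rfl⟩
  · intro v hv
    have := ((hA v).1 (Finset.mem_coe.1 hv)).2
    simpa using this

end Graph

section Sigma

lemma muH_nonneg (q k : ℕ) (hq : 2 ≤ q) : 0 ≤ muH q (k : ℤ) := by
  have hq' : (2:ℚ) ≤ q := by exact_mod_cast hq
  unfold muH
  have h : ∀ j : ℕ, (0:ℚ) ≤ (q:ℚ) ^ j - (-1:ℚ) ^ j := by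
    intro j
    have h1 : (1:ℚ) ≤ (q:ℚ) ^ j := one_le_pow₀ (by linarith)
    rcases neg_one_pow_eq_or ℚ j with h | h <;> rw [h] <;> linarith
  have e : (k:ℤ) + 1 = ((k + 1 : ℕ) : ℤ) := by push_cast; ring
  rw [e]
  simp only [zpow_natCast]
  apply div_nonneg (mul_nonneg (h _) (h _))
  nlinarith

lemma muH_lower (q m : ℕ) (hq : 2 ≤ q) (hm : 1 ≤ m) :
    (q:ℚ) ^ (2 * m) / ((q:ℚ) + 1) ≤ muH q (m : ℤ) := by
  have hq' : (2:ℚ) ≤ q := by exact_mod_cast hq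
  unfold muH
  have e : (m:ℤ) + 1 = ((m + 1 : ℕ) : ℤ) := by push_cast; ring
  rw [e]
  simp only [zpow_natCast]
  have hd : (0:ℚ) < (q:ℚ) ^ 2 - 1 := by nlinarith
  rw [div_le_div_iff₀ (by linarith) hd]
  have key : (q:ℚ) ^ (2 * m) * ((q:ℚ) - 1) ≤
      ((q:ℚ) ^ (m + 1) - (-1) ^ (m + 1)) * ((q:ℚ) ^ m - (-1) ^ m) := by
    have h1 : (1:ℚ) ≤ (q:ℚ) ^ m := one_le_pow₀ (by linarith)
    have e2 : (q:ℚ) ^ (2 * m) = ((q:ℚ) ^ m) ^ 2 := by rw [mul_comm, pow_mul]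
    rcases Nat.even_or_odd m with hev | hod
    · have e1 : ((-1:ℚ)) ^ m = 1 := hev.neg_one_pow
      rw [pow_succ, pow_succ, e1, e2]
      have h2 : (q:ℚ) ≤ (q:ℚ) ^ m := by
        calc (q:ℚ) = (q:ℚ) ^ 1 := by ring
          _ ≤ _ := pow_le_pow_right₀ (by linarith) hm
      nlinarith
    · have e1 : ((-1:ℚ)) ^ m = -1 := hod.neg_one_pow
      rw [pow_succ, pow_succ, e1, e2]
      nlinarith
  nlinarith

lemma sigma_lower (q n d : ℕ) (hq : 2 ≤ q) (hd : d + 1 ≤ n) :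
    2 * (q:ℚ) ^ (2 * n) / ((q:ℚ) + 1) ≤ SigmaNI q n ((d:ℤ) - 1) := by
  obtain ⟨m, rfl⟩ : ∃ m, n = d + m := ⟨n - d, by omega⟩
  have hm : 1 ≤ m := by omega
  have hq' : (2:ℚ) ≤ q := by exact_mod_cast hq
  have hq0 : (0:ℚ) < q := by linarith
  have h1 := muH_lower q m hq hm
  have hsq : (0:ℚ) < (q:ℚ) ^ 2 - 1 := by nlinarith
  have a1 : ((d + m : ℕ) : ℤ) - ((d:ℤ) - 1) - 1 = (m : ℤ) := by push_cast; ring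
  have a2 : 2 * ((d:ℤ) - 1) + 2 = ((2 * d : ℕ) : ℤ) := by push_cast; ring
  have hmain : 2 * (q:ℚ) ^ (2 * (d + m)) / ((q:ℚ) + 1) ≤
      2 * (q:ℚ) ^ (2 * d) * muH q (m : ℤ) := by
    calc 2 * (q:ℚ) ^ (2 * (d + m)) / ((q:ℚ) + 1) =
        2 * (q:ℚ) ^ (2 * d) * ((q:ℚ) ^ (2 * m) / ((q:ℚ) + 1)) := by
          rw [mul_add, pow_add]; ring
      _ ≤ _ := mul_le_mul_of_nonneg_left h1 (by positivity)
  unfold SigmaNI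
  rw [a1, a2]
  simp only [zpow_natCast]
  split_ifs with hodd
  · have a3 : ((d + m : ℕ) : ℤ) - ((d:ℤ) - 1) - 2 = ((m - 1 : ℕ) : ℤ) := by
      push_cast [Nat.cast_sub hm]; ring
    rw [a3]
    have h2 := muH_nonneg q (m - 1) hq
    have h3 : (1:ℚ) ≤ (q:ℚ) ^ m := one_le_pow₀ (by linarith)
    have h4 : 0 ≤ 4 * muH q ((m - 1 : ℕ) : ℤ) * ((q:ℚ) ^ m - 1) /
        ((q:ℚ) ^ (((d + m : ℕ) : ℤ) - 3 * ((d:ℤ) - 1) - 5) * ((q:ℚ) ^ 2 - 1)) := by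
      apply div_nonneg
      · exact mul_nonneg (by linarith) (by linarith)
      · exact mul_nonneg (zpow_nonneg hq0.le _) hsq.le
    linarith
  · have h2 : 0 ≤ muH q (((d + m : ℕ) : ℤ) - ((d:ℤ) - 1) - 3) := by
      rcases Nat.lt_or_ge m 2 with h | h
      · have : m = 1 := by omega
        subst this
        have a3 : ((d + 1 : ℕ) : ℤ) - ((d:ℤ) - 1) - 3 = -1 := by push_cast; ring
        rw [a3]
        simp [muH]
      · have a3 : ((d + m : ℕ) : ℤ) - ((d:ℤ) - 1) - 3 = ((m - 2 : ℕ) : ℤ) := by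
          push_cast [Nat.cast_sub h]; ring
        rw [a3]
        exact muH_nonneg q _ hq
    have h3 : 0 ≤ 2 * ((q:ℚ) ^ (4:ℤ) * muH q (((d + m : ℕ) : ℤ) - ((d:ℤ) - 1) - 3) +
        (q:ℚ) ^ 2 - 1) / ((q:ℚ) ^ 2 - 1) := by
      apply div_nonneg _ hsq.le
      have : 0 ≤ (q:ℚ) ^ (4:ℤ) * muH q (((d + m : ℕ) : ℤ) - ((d:ℤ) - 1) - 3) :=
        mul_nonneg (zpow_nonneg hq0.le _) h2
      linarith
    have h4 : 0 ≤ 2 * (q:ℚ) ^ (2 * d) := by positivity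
    nlinarith [mul_nonneg h4 h3]

end Sigma

section Final

lemma goodField_of_card {p hh q : ℕ} (hp : p.Prime) (hq : q = p ^ hh) (h2 : 2 ≤ q)
    (F : Type) [Field F] [Fintype F] (hc : Fintype.card F = q ^ 2) : GoodField q F := by
  refine ⟨h2, hc, ?_⟩
  obtain ⟨r, hr⟩ := CharP.exists F
  obtain ⟨k, hrp, hk⟩ := FiniteField.card F r
  have hdvd : r ∣ p ^ (hh * 2) := by
    rw [pow_mul, ← hq, ← hc, hk]; exact dvd_pow_self _ k.pos.ne'
  have : r = p := (Nat.prime_dvd_prime_iff_eq hrp hp).1 (hrp.dvd_of_dvd_pow hdvd)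
  subst this
  haveI : Fact r.Prime := ⟨hp⟩
  intro x y
  rw [hq]
  exact add_pow_char_pow x y ..

variable {p q n : ℕ} {F : Type} [Field F] [Fintype F]

lemma codeword_meet {c : Submodule F (Fin (2*n+2) → F) → ZMod p}
    (hc : IsCodeword p q n c) {P μ : Submodule F (Fin (2*n+2) → F)} (hP : c P ≠ 0)
    (hμ : IsGenerator q n μ) (hle : P ≤ μ) :
    ∃ P', P' ≠ P ∧ c P' ≠ 0 ∧ P' ≤ μ := by
  by_contra hcon
  push Not at hcon
  have h := hc.2 μ hμ
  have hPp : IsHermPoint q P := by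
    by_contra h'
    exact hP (hc.1 P h')
  rw [finsum_mem_def, finsum_eq_single _ P] at h
  · rw [Set.indicator_of_mem (show P ∈ {P | IsHermPoint q P ∧ P ≤ μ} from ⟨hPp, hle⟩)] at h
    exact hP h
  · intro P' hne
    by_cases hm : P' ∈ {P | IsHermPoint q P ∧ P ≤ μ}
    · rw [Set.indicator_of_mem hm]
      by_contra h0
      exact hcon P' hne h0 hm.2
    · exact Set.indicator_of_notMem hm _

open scoped Classical in
/-- The core: existence of a dense, non-generator `n`-space. -/
lemma GoodField.core (H : GoodField q F) (hn : 2 ≤ n) (δ : ℝ) (hδ : 0 < δ) (K : ℕ)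
    (hK : 32 * δ ≤ K) (hqK1 : 8 * (K:ℝ) ≤ q) (hqK2 : (K:ℝ) ^ 2 < δ * q)
    (hqc : 1 < (1/8 : ℝ) * ((1/8) / (2 * δ)) ^ (n + 2) * q) (hq16 : 16 < q)
    {c : Submodule F (Fin (2*n+2) → F) → ZMod p}
    (hc : IsCodeword p q n c) (hc0 : c ≠ 0) (hw : (wt c : ℝ) ≤ δ * (q:ℝ) ^ (2 * n - 1)) :
    ∃ U : Submodule F (Fin (2*n+2) → F), Module.finrank F U = n + 1 ∧
      Module.finrank F ↥(U ⊓ polar q U) + 1 ≤ n ∧ ¬ TotallyIsotropic q U ∧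
      (1/16 : ℝ) * (q:ℝ) ^ (2 * n + 1) <
        ((Finset.univ.filter (fun v : Fin (2*n+2) → F =>
          (v ≠ 0 ∧ c (Submodule.span F {v}) ≠ 0) ∧ v ∈ U)).card : ℝ) := by
  have hq := H.two_le
  have hq0 : (0:ℝ) < q := by exact_mod_cast (by omega : 0 < q)
  have hpt : ∀ P, c P ≠ 0 → IsHermPoint q P := fun P h => by
    by_contra h'
    exact h (hc.1 P h')
  set S : Finset (Fin (2*n+2) → F) :=
    Finset.univ.filter (fun v => v ≠ 0 ∧ c (Submodule.span F {v}) ≠ 0) with hSdef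
  have memS : ∀ v, v ∈ S ↔ v ≠ 0 ∧ c (Submodule.span F {v}) ≠ 0 := by
    intro v; simp [hSdef]
  have hq21 : 1 ≤ q ^ 2 := Nat.one_le_pow _ _ (by omega)
  have hScard : (S.card : ℝ) ≤ δ * (q:ℝ) ^ (2 * n + 1) := by
    have h1 := H.convert (fun P => c P ≠ 0) (fun P h => (hpt P h).1) S memS
    have h2 : (S.card : ℝ) = (wt c : ℝ) * ((q:ℝ) ^ 2 - 1) := by
      have : S.card = wt c * (q ^ 2 - 1) := h1
      rw [this]; push_cast [Nat.cast_sub hq21]; ring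
    rw [h2]
    have h3 : (q:ℝ) ^ (2 * n + 1) = (q:ℝ) ^ (2 * n - 1) * (q:ℝ) ^ 2 := by
      rw [← pow_add]; congr 1; omega
    rw [h3]
    have h4 : (0:ℝ) ≤ wt c := Nat.cast_nonneg _
    calc (wt c : ℝ) * ((q:ℝ) ^ 2 - 1) ≤ wt c * (q:ℝ) ^ 2 := by nlinarith
      _ ≤ (δ * (q:ℝ) ^ (2 * n - 1)) * (q:ℝ) ^ 2 := mul_le_mul_of_nonneg_right hw (by positivity)
      _ = _ := by ring
  have hSiso : ∀ v ∈ S, herm q v v = 0 := fun v hv =>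
    (hpt _ ((memS v).1 hv).2).2 v (Submodule.mem_span_singleton_self v)
  -- rich generators
  let G : Finset (Submodule F (Fin (2*n+2) → F)) :=
    (Set.toFinite {π | IsGenerator q n π ∧
      (1/16 : ℝ) * (q:ℝ) ^ (2 * n + 1) ≤ ((S.filter (fun w => w ∈ π)).card : ℝ)}).toFinset
  have memG : ∀ π, π ∈ G ↔ IsGenerator q n π ∧
      (1/16 : ℝ) * (q:ℝ) ^ (2 * n + 1) ≤ ((S.filter (fun w => w ∈ π)).card : ℝ) := by
    intro π; simp [G]
  have hGK : G.card ≤ K := H.rich_bound S (1/16) δ hδ hScard G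
    (fun π h => ((memG π).1 h).1.1) (fun π h => ((memG π).1 h).2) K (by linarith) hqK2
  set T := S.filter (fun w => ¬ ∃ π ∈ G, w ∈ π) with hTdef
  have hTS : T ⊆ S := Finset.filter_subset _ _
  have hspan : ∀ (w : Fin (2*n+2) → F) (a : F), a ≠ 0 →
      Submodule.span F {a • w} = Submodule.span F {w} := fun w a ha =>
    Submodule.span_singleton_smul_eq (IsUnit.mk0 a ha) w
  have hdeg : ∀ v ∈ S, (1/8 : ℝ) * (q:ℝ) ^ (2 * n + 1) ≤
      ((T.filter (fun w => herm q w v = 0)).card : ℝ) := by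
    intro v hv
    have hv' := (memS v).1 hv
    have := H.nbr hn hv'.1 (hSiso v hv) T G (fun π h => ((memG π).1 h).1) ?_ ?_ ?_
    · linarith
    · intro w hw a ha
      simp only [hTdef, Finset.mem_filter, memS] at hw ⊢
      rw [hspan w a ha]
      refine ⟨⟨smul_ne_zero ha hw.1.1, hw.1.2⟩, ?_⟩
      rintro ⟨π, hπ, h⟩
      exact hw.2 ⟨π, hπ, (π.smul_mem_iff ha).1 h⟩
    · intro μ hμ
      obtain ⟨hgen, hle⟩ := mem_gens.1 hμ
      obtain ⟨P', hne, hP', hle'⟩ := codeword_meet hc hv'.2 hgen hle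
      have hd := (hpt P' hP').1
      have hnb : P' ≠ ⊥ := by rintro rfl; simp at hd
      obtain ⟨w, hw, hw0⟩ := Submodule.exists_mem_ne_zero_of_ne_bot hnb
      have hsp : Submodule.span F {w} = P' := by
        apply Submodule.eq_of_le_of_finrank_eq
        · rwa [Submodule.span_singleton_le_iff_mem]
        · rw [hd, finrank_span_singleton hw0]
      refine ⟨w, hle' hw, ?_, ?_⟩
      · intro hcon
        apply hne
        rw [← hsp]
        apply Submodule.eq_of_le_of_finrank_eq
        · rwa [Submodule.span_singleton_le_iff_mem]
        · rw [finrank_span_singleton hw0, finrank_span_singleton hv'.1]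
      · by_cases h : ∃ π ∈ G, w ∈ π
        · exact Or.inr h
        · left
          simp only [hTdef, Finset.mem_filter, memS]
          exact ⟨⟨hw0, by rw [hsp]; exact hP'⟩, h⟩
    · have : (G.card : ℝ) ≤ K := by exact_mod_cast hGK
      linarith
  -- S is nonempty
  obtain ⟨v, hv⟩ : ∃ v, v ∈ S := by
    obtain ⟨P, hP⟩ := Function.ne_iff.1 hc0
    have hP : c P ≠ 0 := hP
    have hd := (hpt P hP).1
    have hnb : P ≠ ⊥ := by rintro rfl; simp at hd
    obtain ⟨w, hw, hw0⟩ := Submodule.exists_mem_ne_zero_of_ne_bot hnb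
    have hsp : Submodule.span F {w} = P := by
      apply Submodule.eq_of_le_of_finrank_eq
      · rwa [Submodule.span_singleton_le_iff_mem]
      · rw [hd, finrank_span_singleton hw0]
    exact ⟨w, (memS w).2 ⟨hw0, by rw [hsp]; exact hP⟩⟩
  have hTpos : (1/8 : ℝ) * (q:ℝ) ^ (2 * n + 1) ≤ T.card :=
    (hdeg v hv).trans (by exact_mod_cast Finset.card_le_card (Finset.filter_subset _ _))
  have hTcard : (T.card : ℝ) ≤ δ * (q:ℝ) ^ (2 * n + 1) :=
    le_trans (by exact_mod_cast Finset.card_le_card hTS) hScard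
  obtain ⟨U, hU, hUc⟩ := H.exists_dense T (1/8) δ (by norm_num) hδ hTcard hTpos
    (fun v hv => hdeg v (hTS hv)) hqc
  have hUc' : (1/16 : ℝ) * (q:ℝ) ^ (2 * n + 1) < ((T.filter (fun w => w ∈ U)).card : ℝ) := by
    linarith
  have hTU : T.filter (fun w => w ∈ U) ⊆ S.filter (fun w => w ∈ U) :=
    Finset.filter_subset_filter _ hTS
  have hbig : ¬ (T.filter (fun w => w ∈ U)).card ≤ q ^ (2 * n) := by
    intro hle
    have h1 : ((T.filter (fun w => w ∈ U)).card : ℝ) ≤ (q:ℝ) ^ (2 * n) := by exact_mod_cast hle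
    have h2 : (q:ℝ) ^ (2 * n + 1) = q * (q:ℝ) ^ (2 * n) := by ring
    have h3 : (0:ℝ) < (q:ℝ) ^ (2 * n) := by positivity
    have h4 : (16:ℝ) < q := by exact_mod_cast hq16
    rw [h2] at hUc'
    nlinarith
  have hUd : Module.finrank F U = n + 1 := by
    by_contra hne
    apply hbig
    refine (Finset.card_le_card (Finset.filter_subset_filter _ (Finset.subset_univ T))).trans ?_
    rw [H.card_mem]
    exact Nat.pow_le_pow_right (by omega) (by omega)
  have hUti : ¬ TotallyIsotropic q U := by
    intro hti
    have hmem : U ∈ G := by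
      rw [memG]
      refine ⟨⟨hUd, hti⟩, hUc'.le.trans ?_⟩
      exact_mod_cast Finset.card_le_card hTU
    have hemp : T.filter (fun w => w ∈ U) = ∅ := by
      apply Finset.filter_false_of_mem
      intro w hw hwU
      exact (Finset.mem_filter.1 hw).2 ⟨U, hmem, hwU⟩
    apply hbig
    rw [hemp]; simp
  refine ⟨U, hUd, ?_, hUti, ?_⟩
  · have hlt : Module.finrank F ↥(U ⊓ polar q U) < Module.finrank F U := by
      apply Submodule.finrank_lt_finrank_of_lt
      refine lt_of_le_of_ne inf_le_left fun h => ?_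
      exact hUti ((H.ti_iff U).2 (inf_eq_left.1 h))
    by_contra hcon
    have hrk : Module.finrank F ↥(U ⊓ polar q U) = n := by omega
    apply hbig
    rw [← H.card_iso_rank_one U n hUd hrk]
    apply Finset.card_le_card
    intro w hw
    simp only [Finset.mem_filter] at hw
    exact mem_iso.2 ⟨hw.2, hSiso w (hTS hw.1)⟩
  · refine hUc'.trans_le ?_
    have : S.filter (fun w => w ∈ U) = (Finset.univ.filter (fun v : Fin (2*n+2) → F =>
          (v ≠ 0 ∧ c (Submodule.span F {v}) ≠ 0) ∧ v ∈ U)) := by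
      ext w; simp [memS]
    rw [← this]
    exact_mod_cast Finset.card_le_card hTU

lemma arith_final (n p : ℕ) (hn : 2 ≤ n) (hp : 2 ≤ p) (q : ℕ) (hq : 1000 ≤ q) (hqp : 100 * p ≤ q)
    (Y : ℝ) (hY0 : 0 ≤ Y) (hY : Y * ((q:ℝ) ^ 2 - 1) ≤ 2 * ((q + 1) * (q:ℝ) ^ (2 * n))) :
    ((p:ℝ) - 1) / p * Y < 2 * (q:ℝ) ^ (2 * n) / ((q:ℝ) + 1) - 1 / (64 * p) * (q:ℝ) ^ (2 * n - 1) := by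
  have hq' : (1000:ℝ) ≤ q := by exact_mod_cast hq
  have hp' : (2:ℝ) ≤ p := by exact_mod_cast hp
  have hqp' : 100 * (p:ℝ) ≤ q := by exact_mod_cast hqp
  have e1 : (q:ℝ) ^ (2 * n) = q * (q:ℝ) ^ (2 * n - 1) := by
    rw [← pow_succ']; congr 1; omega
  set z := (q:ℝ) ^ (2 * n - 1) with hz
  have hz0 : 0 < z := by positivity
  rw [e1] at hY ⊢
  set x : ℝ := (q:ℝ) with hx
  set s : ℝ := (p:ℝ) with hs
  have h1 : Y * (x - 1) ≤ 2 * x * z := by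
    have : (x + 1) * (Y * (x - 1)) ≤ (x + 1) * (2 * x * z) := by nlinarith
    exact le_of_mul_le_mul_left this (by linarith)
  have h2 : Y ≤ (2 + 4 / x) * z := by
    have h3 : (2 * x) ≤ (2 + 4 / x) * (x - 1) := by
      have : (2 + 4 / x) * (x - 1) = 2 * x + 2 - 4 / x := by field_simp; ring
      rw [this]
      have : 4 / x ≤ 1 := by rw [div_le_one (by linarith)]; linarith
      linarith
    have h4 : Y * (x - 1) ≤ (2 + 4 / x) * z * (x - 1) := by
      refine h1.trans ?_
      nlinarith [mul_le_mul_of_nonneg_right h3 hz0.le]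
    exact le_of_mul_le_mul_right h4 (by linarith)
  have h5 : (2 - 2 / x) * z ≤ 2 * (x * z) / (x + 1) := by
    rw [le_div_iff₀ (by linarith)]
    have : (2 - 2 / x) * (x + 1) = 2 * x - 2 / x := by field_simp; ring
    have h6 : 0 ≤ 2 / x := by positivity
    nlinarith
  have hs0 : 0 < s := by linarith
  have h7 : (s - 1) / s * Y ≤ (s - 1) / s * ((2 + 4 / x) * z) :=
    mul_le_mul_of_nonneg_left h2 (div_nonneg (by linarith) hs0.le)
  have h8 : (s - 1) / s = 1 - 1 / s := by field_simp
  set u := 1 / s with hu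
  have hu0 : 0 < u := by positivity
  set t := 1 / x with ht
  have ht0 : 0 < t := by positivity
  have htu : 100 * t ≤ u := by
    rw [hu, ht, mul_one_div, div_le_div_iff₀ (by linarith) hs0]; linarith
  have h9 : 4 / x = 4 * t := by rw [ht]; ring
  have h10 : 2 / x = 2 * t := by rw [ht]; ring
  have h11 : 1 / (64 * s) = u / 64 := by rw [hu]; field_simp
  rw [h11]
  rw [h8, h9] at h7
  rw [h8]
  rw [h10] at h5
  have h12 : (1 - u) * ((2 + 4 * t) * z) < (2 - 2 * t) * z - u / 64 * z := by
    have : (1 - u) * (2 + 4 * t) < 2 - 2 * t - u / 64 := by nlinarith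
    nlinarith
  linarith

end Final

/-- For fixed `p`, `n` and `δ` there are constants `C, Q > 0` such that for all
`q = p^h ≥ Q` and every nonzero code word of weight at most `δ·q^(2n-1)` there is
an `n`-space `π` whose symmetric difference with `π^σ` captures more than
`C·q^(2n-1)` points of the support, while
`((p-1)/p)·|(π Δ π^σ) ∩ H| < Σ_(n,i) - C·q^(2n-1)`. -/
theorem stmt15 (p n : ℕ) (hp : p.Prime) (hn : 2 ≤ n) (δ : ℝ) (hδ : 0 < δ) :
    ∃ C Q : ℝ, 0 < C ∧ 0 < Q ∧
      ∀ (hh q : ℕ), q = p ^ hh → Q ≤ (q:ℝ) →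
      ∀ (F : Type) [Field F] [Fintype F], Fintype.card F = q ^ 2 →
      ∀ c : Submodule F (Fin (2*n+2) → F) → ZMod p,
        IsCodeword p q n c → c ≠ 0 → (wt c : ℝ) ≤ δ * (q:ℝ)^(2*n-1) →
        ∃ (π : Submodule F (Fin (2*n+2) → F)) (i : ℤ),
          Module.finrank F π = n + 1 ∧
          (Module.finrank F ↥(π ⊓ polar q π) : ℤ) = i + 1 ∧
          -1 ≤ i ∧ i ≤ (n:ℤ) - 2 ∧
          C * (q:ℝ)^(2*n-1) <
            (Nat.card {P : Submodule F (Fin (2*n+2) → F) //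
              c P ≠ 0 ∧ Xor' (P ≤ π) (P ≤ polar q π)} : ℝ) ∧
          ((p:ℝ) - 1) / (p:ℝ) *
            (Nat.card {P : Submodule F (Fin (2*n+2) → F) //
              IsHermPoint q P ∧ Xor' (P ≤ π) (P ≤ polar q π)} : ℝ)
            < ((SigmaNI q n i : ℚ) : ℝ) - C * (q:ℝ)^(2*n-1) := by
  classical
  set K : ℕ := ⌈32 * δ⌉₊ with hKdef
  set cc : ℝ := (1/8 : ℝ) * ((1/8) / (2 * δ)) ^ (n + 2) with hcc
  have hcc0 : 0 < cc := by positivity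
  have hp2 := hp.two_le
  have hp0 : (0:ℝ) < p := by exact_mod_cast hp.pos
  refine ⟨1 / (64 * p), 1000 + 100 * p + 8 * K + (K:ℝ) ^ 2 / δ + 1 / cc, by positivity,
    by positivity, ?_⟩
  intro hh q hqp hQ F _ _ hcard c hc hc0 hw
  have t1 : (0:ℝ) ≤ (K:ℝ) ^ 2 / δ := by positivity
  have t2 : (0:ℝ) < 1 / cc := by positivity
  have t3 : (0:ℝ) ≤ 8 * K := by positivity
  have t4 : (0:ℝ) ≤ 100 * p := by positivity
  have hq1000' : (1000:ℝ) ≤ q := by linarith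
  have hq1000 : 1000 ≤ q := by exact_mod_cast hq1000'
  have hq100p : 100 * p ≤ q := by
    have : (100:ℝ) * p ≤ q := by linarith
    exact_mod_cast this
  have H := goodField_of_card hp hqp (by omega) F hcard
  obtain ⟨U, hUd, hrad, hUti, hUc⟩ := H.core hn δ hδ K (Nat.le_ceil _) (by linarith)
    (by
      have : (K:ℝ) ^ 2 / δ < q := by linarith
      rw [div_lt_iff₀ hδ] at this; linarith)
    (by
      have : 1 / cc < q := by linarith
      rw [div_lt_iff₀ hcc0] at this; change 1 < cc * (q:ℝ); linarith) (by omega) hc hc0 hw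
  have hpt : ∀ P, c P ≠ 0 → IsHermPoint q P := fun P h => by
    by_contra h'
    exact h (hc.1 P h')
  have hq21 : 1 ≤ q ^ 2 := Nat.one_le_pow _ _ (by omega)
  have hq0 : (0:ℝ) < q := by linarith
  refine ⟨U, (Module.finrank F ↥(U ⊓ polar q U) : ℤ) - 1, hUd, by ring, by omega, by omega, ?_, ?_⟩
  · have h1 := H.convert (fun P => c P ≠ 0 ∧ Xor' (P ≤ U) (P ≤ polar q U))
      (fun P h => (hpt P h.1).1)
    obtain ⟨B, hB⟩ : ∃ B : Finset (Fin (2*n+2) → F), ∀ v, v ∈ B ↔ v ≠ 0 ∧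
          (c (Submodule.span F {v}) ≠ 0 ∧ Xor' (Submodule.span F {v} ≤ U)
            (Submodule.span F {v} ≤ polar q U)) :=
      ⟨Finset.univ.filter (fun v => v ≠ 0 ∧
          (c (Submodule.span F {v}) ≠ 0 ∧ Xor' (Submodule.span F {v} ≤ U)
            (Submodule.span F {v} ≤ polar q U))), fun v => by
        simp only [Finset.mem_filter, Finset.mem_univ, true_and]⟩
    have h2 : (Finset.univ.filter (fun v : Fin (2*n+2) → F =>
          (v ≠ 0 ∧ c (Submodule.span F {v}) ≠ 0) ∧ v ∈ U)).card ≤ B.card +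
        (Finset.univ.filter (fun v => v ∈ U ⊓ polar q U)).card := by
      refine le_trans (Finset.card_le_card ?_) (Finset.card_union_le _ _)
      intro v hv
      simp only [Finset.mem_filter, Finset.mem_univ, true_and, Finset.mem_union,
        Submodule.mem_inf, hB, Submodule.span_singleton_le_iff_mem] at hv ⊢
      by_cases h : v ∈ polar q U
      · exact Or.inr ⟨hv.2, h⟩
      · exact Or.inl ⟨hv.1.1, hv.1.2, Or.inl ⟨hv.2, h⟩⟩
    rw [h1 B hB, H.card_mem] at h2
    have h3 : q ^ (2 * Module.finrank F ↥(U ⊓ polar q U)) ≤ q ^ (2 * n) :=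
      Nat.pow_le_pow_right (by omega) (by omega)
    have h4 := h2.trans (Nat.add_le_add_left h3 _)
    have h5 := (Nat.cast_le (α := ℝ)).2 h4
    push_cast [Nat.cast_sub hq21] at h5
    set N : ℝ := (Nat.card {P : Submodule F (Fin (2*n+2) → F) //
              c P ≠ 0 ∧ Xor' (P ≤ U) (P ≤ polar q U)} : ℝ) with hN
    have hN0 : 0 ≤ N := Nat.cast_nonneg _
    have e1 : (q:ℝ) ^ (2 * n) = q * (q:ℝ) ^ (2 * n - 1) := by
      rw [← pow_succ']; congr 1; omega
    have e2 : (q:ℝ) ^ (2 * n + 1) = (q:ℝ) ^ 2 * (q:ℝ) ^ (2 * n - 1) := by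
      rw [← pow_add]; congr 1; omega
    have hz : (0:ℝ) < (q:ℝ) ^ (2 * n - 1) := by positivity
    rw [e2] at hUc
    rw [e1] at h5
    set z := (q:ℝ) ^ (2 * n - 1)
    have h6 : (1/16 : ℝ) * ((q:ℝ) ^ 2 * z) < N * ((q:ℝ) ^ 2 - 1) + q * z := lt_of_lt_of_le hUc h5
    have h7 : (q:ℝ) * z ≤ (1/32 : ℝ) * ((q:ℝ) ^ 2 * z) := by
      have : (q:ℝ) ≤ 1/32 * (q:ℝ) ^ 2 := by nlinarith
      nlinarith
    have h8 : (q:ℝ) ^ 2 * (1/32 * z) < (q:ℝ) ^ 2 * N := by nlinarith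
    have h9 : 1/32 * z < N := lt_of_mul_lt_mul_left h8 (by positivity)
    refine lt_of_le_of_lt ?_ h9
    apply mul_le_mul_of_nonneg_right _ hz.le
    have hp2' : (2:ℝ) ≤ p := by exact_mod_cast hp2
    rw [div_le_div_iff₀ (by positivity) (by norm_num)]
    linarith
  · have h1 := H.convert (fun P => IsHermPoint q P ∧ Xor' (P ≤ U) (P ≤ polar q U))
      (fun P h => h.1.1)
    have hpU : Module.finrank F (polar q U) = n + 1 := by
      have := H.finrank_polar U; omega
    have hpti : ¬ TotallyIsotropic q (polar q U) := by
      intro h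
      rw [H.ti_iff, H.polar_polar] at h
      have := Submodule.eq_of_le_of_finrank_eq h (by omega)
      apply hUti
      rw [H.ti_iff, this]
    have h2 := H.card_iso_le U n hUd hUti
    have h3 := H.card_iso_le (polar q U) n hpU hpti
    have h4 : (Finset.univ.filter (fun v : Fin (2*n+2) → F => v ≠ 0 ∧
          (IsHermPoint q (Submodule.span F {v}) ∧ Xor' (Submodule.span F {v} ≤ U)
            (Submodule.span F {v} ≤ polar q U)))).card ≤
        (iso q U).card + (iso q (polar q U)).card := by
      refine le_trans (Finset.card_le_card ?_) (Finset.card_union_le _ _)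
      intro v hv
      simp only [Finset.mem_filter, Finset.mem_univ, true_and, Finset.mem_union, mem_iso,
        Submodule.span_singleton_le_iff_mem] at hv ⊢
      have hvv := hv.2.1.2 v (Submodule.mem_span_singleton_self v)
      rcases hv.2.2 with h | h
      · exact Or.inl ⟨h.1, hvv⟩
      · exact Or.inr ⟨h.1, hvv⟩
    rw [h1 _ (by intro v; simp only [Finset.mem_filter, Finset.mem_univ, true_and])] at h4
    have h5 := h4.trans (Nat.add_le_add h2 h3)
    have h6 := (Nat.cast_le (α := ℝ)).2 h5
    push_cast [Nat.cast_sub hq21] at h6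
    have h7 := arith_final n p hn hp2 q hq1000 hq100p _ (Nat.cast_nonneg _)
      (h6.trans_eq (by ring))
    refine h7.trans_le (sub_le_sub_right ?_ _)
    have h8 := sigma_lower q n (Module.finrank F ↥(U ⊓ polar q U)) (by omega) hrad
    have h9 := (Rat.cast_le (K := ℝ)).2 h8
    push_cast at h9
    exact h9

end HermCode
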